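/- arXiv:0911.4467 — 5 statements merged into one kernel-verified Lean document; each statement's English description precedes it below -/
import Mathlib

section
/- Let γ : I → ℝ³ be a smooth curve such that for every u ∈ I the velocity γ'(u) is a nonzero null vector (⟨γ'(u),γ'(u)⟩ = 0) which is future-directed (⟨γ'(u), e₁+e₃⟩ < 0), and γ'(u), γ''(u) are linearly independent (no flex points). Then ⟨γ''(u),γ''(u)⟩ > 0 for all u, and there exists an interval J and a smooth orientation-preserving diffeomorphism φ : J → I such that the reparametrized curve γ∘φ satisfies ⟨(γ∘φ)'',(γ∘φ)''⟩ ≡ 1, i.e. γ∘φ is parametrized by pseudo-arc. -/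
noncomputable section

/-- The Minkowski bilinear form on `ℝ³`: `⟨x,y⟩ = -(x¹y³ + x³y¹) + x²y²`. -/
def mink (x y : Fin 3 → ℝ) : ℝ := -(x 0 * y 2 + x 2 * y 0) + x 1 * y 1

lemma mink_pos_aux (v w : Fin 3 → ℝ) (h0 : mink v v = 0) (hf : mink v ![1, 0, 1] < 0)
    (h1 : mink v w = 0) (hl : LinearIndependent ℝ ![v, w]) : 0 < mink w w := by
  have hne : ∀ a b : ℝ, b ≠ 0 → a • v = b • w → False := by
    intro a b hb hab
    rw [LinearIndependent.pair_iff] at hl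
    have := hl a (-b) (by rw [hab]; simp)
    exact hb (by linarith [this.2])
  simp [mink] at h0 hf h1 ⊢
  have key : ∀ a b c x y z : ℝ, 0 < a → -(a*c+c*a)+b*b = 0 → -(a*z+c*x)+b*y = 0 →
      (x * b = a * y → x * c = a * z → False) → 0 < -(x*z+z*x)+y*y := by
    intro a b c x y z ha h0 h1 hn
    have e : a^2 * (-(x*z+z*x)+y*y) = (a*y - b*x)^2 := by
      linear_combination (-x^2)*h0 + 2*a*x*h1
    have hne : a*y - b*x ≠ 0 := by
      intro h
      apply hn
      · linarith
      · have : a * (x * c - a * z) = 0 := by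
          linear_combination (-x) * h0 + a * h1 - b * h
        have := (mul_eq_zero.mp this).resolve_left ha.ne'
        linarith
    have : 0 < a^2 * (-(x*z+z*x)+y*y) := by rw [e]; positivity
    exact (pos_iff_pos_of_mul_pos this).mp (by positivity)
  have hv : 0 < v 0 ∨ 0 < v 2 := by
    by_contra! h
    linarith [h.1, h.2]
  rcases hv with hv | hv
  · have := key (v 0) (v 1) (v 2) (w 0) (w 1) (w 2) hv (by linarith) (by linarith) (by
      intro h2 h3
      apply hne (w 0) (v 0) hv.ne'
      ext i; fin_cases i <;> simp <;> linarith)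
    linarith
  · have := key (v 2) (v 1) (v 0) (w 2) (w 1) (w 0) hv (by linarith) (by linarith) (by
      intro h2 h3
      apply hne (w 2) (v 2) hv.ne'
      ext i; fin_cases i <;> simp <;> linarith)
    linarith

lemma mink_contDiff (v w : ℝ → Fin 3 → ℝ) (hv : ContDiff ℝ (⊤ : ℕ∞) v)
    (hw : ContDiff ℝ (⊤ : ℕ∞) w) : ContDiff ℝ (⊤ : ℕ∞) (fun u => mink (v u) (w u)) := by
  rw [contDiff_pi] at hv hw
  unfold mink
  exact ((((hv 0).mul (hw 2)).add ((hv 2).mul (hw 0))).neg).add ((hv 1).mul (hw 1))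

lemma mink_deriv (v : ℝ → Fin 3 → ℝ) (v' : Fin 3 → ℝ) (u : ℝ) (h : HasDerivAt v v' u) :
    HasDerivAt (fun u => mink (v u) (v u)) (2 * mink (v u) v') u := by
  rw [hasDerivAt_pi] at h
  unfold mink
  refine (((((h 0).mul (h 2)).add ((h 2).mul (h 0))).neg).add
    ((h 1).mul (h 1))).congr_deriv ?_
  ring

lemma mink_comb (v w : Fin 3 → ℝ) (a b : ℝ) :
    mink (a • v + b • w) (a • v + b • w)
      = a^2 * mink v v + 2*a*b*mink v w + b^2 * mink w w := by
  simp [mink]; ring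

theorem stmt2 (I : Set ℝ) (hIopen : IsOpen I) (hIconn : I.OrdConnected)
    (γ : ℝ → Fin 3 → ℝ) (hγ : ContDiff ℝ (⊤ : ℕ∞) γ)
    (hnull : ∀ u ∈ I, mink (deriv γ u) (deriv γ u) = 0)
    (hfuture : ∀ u ∈ I, mink (deriv γ u) ![1, 0, 1] < 0)
    (hnoflex : ∀ u ∈ I, LinearIndependent ℝ ![deriv γ u, deriv (deriv γ) u]) :
    (∀ u ∈ I, 0 < mink (deriv (deriv γ) u) (deriv (deriv γ) u)) ∧
    ∃ J : Set ℝ, IsOpen J ∧ J.OrdConnected ∧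
      ∃ φ : ℝ → ℝ, ContDiffOn ℝ (⊤ : ℕ∞) φ J ∧ Set.BijOn φ J I ∧
        (∀ x ∈ J, 0 < deriv φ x) ∧
        (∀ x ∈ J, mink (deriv (deriv (γ ∘ φ)) x) (deriv (deriv (γ ∘ φ)) x) = 1) := by
  have hγ1 : ContDiff ℝ (⊤ : ℕ∞) (deriv γ) := (contDiff_infty_iff_deriv.mp hγ).2
  have hγ2 : ContDiff ℝ (⊤ : ℕ∞) (deriv (deriv γ)) := (contDiff_infty_iff_deriv.mp hγ1).2
  have hd0 : ∀ u, HasDerivAt γ (deriv γ u) u := fun u =>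
    ((contDiff_infty_iff_deriv.mp hγ).1 u).hasDerivAt
  have hd1 : ∀ u, HasDerivAt (deriv γ) (deriv (deriv γ) u) u := fun u =>
    ((contDiff_infty_iff_deriv.mp hγ1).1 u).hasDerivAt
  have horth : ∀ u ∈ I, mink (deriv γ u) (deriv (deriv γ) u) = 0 := by
    intro u hu
    have h1 := mink_deriv _ _ u (hd1 u)
    have h2 : HasDerivAt (fun u => mink (deriv γ u) (deriv γ u)) 0 u := by
      refine (hasDerivAt_const u (0:ℝ)).congr_of_eventuallyEq ?_
      filter_upwards [hIopen.mem_nhds hu] with t ht using hnull t ht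
    have := h1.unique h2
    linarith
  have hpos : ∀ u ∈ I, 0 < mink (deriv (deriv γ) u) (deriv (deriv γ) u) := fun u hu =>
    mink_pos_aux _ _ (hnull u hu) (hfuture u hu) (horth u hu) (hnoflex u hu)
  refine ⟨hpos, ?_⟩
  set f : ℝ → ℝ := fun u => mink (deriv (deriv γ) u) (deriv (deriv γ) u) with hf
  have hfc : ContDiff ℝ (⊤ : ℕ∞) f := mink_contDiff _ _ hγ2 hγ2
  set g : ℝ → ℝ := fun u => √(√(f u)) with hg
  have hgc : Continuous g := by
    have := hfc.continuous
    fun_prop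
  have hgpos : ∀ u ∈ I, 0 < g u := fun u hu => Real.sqrt_pos.mpr (Real.sqrt_pos.mpr (hpos u hu))
  have hg4 : ∀ u ∈ I, g u ^ 4 = f u := by
    intro u hu
    have : g u ^ 4 = ((√(√(f u)))^2)^2 := by simp only [hg]; ring
    rw [this, Real.sq_sqrt (Real.sqrt_nonneg _), Real.sq_sqrt (hpos u hu).le]
  have hgs : ContDiffOn ℝ (⊤ : ℕ∞) (fun u => (g u)⁻¹) I := by
    apply ContDiffOn.inv _ (fun u hu => (hgpos u hu).ne')
    exact (hfc.contDiffOn.sqrt (fun u hu => (hpos u hu).ne')).sqrt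
      (fun u hu => (Real.sqrt_pos.mpr (hpos u hu)).ne')
  set σ : ℝ → ℝ := fun u => ∫ t in (0:ℝ)..u, g t with hσ
  have hσd : ∀ u, HasStrictDerivAt σ (g u) u := fun u => hgc.integral_hasStrictDerivAt 0 u
  have hσcont : Continuous σ := continuous_iff_continuousAt.mpr fun u => (hσd u).hasDerivAt.continuousAt
  have hmono : StrictMonoOn σ I := by
    apply strictMonoOn_of_deriv_pos hIconn.convex hσcont.continuousOn
    intro u hu
    rw [(hσd u).hasDerivAt.deriv]
    exact hgpos u (interior_subset hu)
  set φ : ℝ → ℝ := Function.invFunOn σ I with hφ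
  have hleft : ∀ u ∈ I, φ (σ u) = u := fun u hu => hmono.injOn.leftInvOn_invFunOn hu
  have hJopen : IsOpen (σ '' I) := by
    rw [isOpen_iff_mem_nhds]
    rintro _ ⟨u, hu, rfl⟩
    rw [← (hσd u).map_nhds_eq (hgpos u hu).ne']
    exact Filter.image_mem_map (hIopen.mem_nhds hu)
  have hφI : ∀ x ∈ σ '' I, φ x ∈ I := by
    rintro _ ⟨u, hu, rfl⟩
    rwa [hleft u hu]
  have hφd : ∀ x ∈ σ '' I, HasDerivAt φ (g (φ x))⁻¹ x := by
    rintro _ ⟨u, hu, rfl⟩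
    rw [hleft u hu]
    refine ((hσd u).to_local_left_inverse (hgpos u hu).ne' ?_).hasDerivAt
    filter_upwards [hIopen.mem_nhds hu] with t ht using hleft t ht
  have hφs : ContDiffOn ℝ (⊤ : ℕ∞) φ (σ '' I) := by
    rw [contDiffOn_infty]
    intro n
    induction n with
    | zero =>
      exact contDiffOn_zero.mpr fun x hx => (hφd x hx).continuousAt.continuousWithinAt
    | succ n ih =>
      push_cast
      rw [contDiffOn_succ_iff_deriv_of_isOpen hJopen]
      refine ⟨fun x hx => (hφd x hx).differentiableAt.differentiableWithinAt, by simp, ?_⟩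
      have := (contDiffOn_infty.mp hgs n).comp ih hφI
      exact this.congr fun x hx => (hφd x hx).deriv
  refine ⟨σ '' I, hJopen, ?_, φ, hφs, ⟨hφI, ?_, ?_⟩, ?_, ?_⟩
  · exact (hIconn.isPreconnected.image σ hσcont.continuousOn).ordConnected
  · rintro _ ⟨u, hu, rfl⟩ _ ⟨v, hv, rfl⟩ h
    rw [hleft u hu, hleft v hv] at h
    rw [h]
  · intro u hu
    exact ⟨σ u, ⟨u, hu, rfl⟩, hleft u hu⟩
  · intro x hx
    rw [(hφd x hx).deriv]
    exact inv_pos.mpr (hgpos _ (hφI x hx))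
  · intro x hx
    have hI := hφI x hx
    have e1 : deriv (γ ∘ φ) =ᶠ[nhds x] fun y => (g (φ y))⁻¹ • deriv γ (φ y) := by
      filter_upwards [hJopen.mem_nhds hx] with y hy
      exact ((hd0 (φ y)).scomp y (hφd y hy)).deriv
    have hc : HasDerivAt (fun u => (g u)⁻¹) (deriv (fun u => (g u)⁻¹) (φ x)) (φ x) :=
      ((hgs.contDiffAt (hIopen.mem_nhds hI)).differentiableAt (by simp)).hasDerivAt
    have hc' := hc.comp x (hφd x hx)
    have hv := (hd1 (φ x)).scomp x (hφd x hx)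
    have e2 := e1.deriv_eq.trans (hc'.smul hv).deriv
    rw [e2]
    simp only [Function.comp, smul_smul]
    rw [add_comm, mink_comb, hnull _ hI, horth _ hI]
    have h4 := hg4 _ hI
    have hp := hgpos _ hI
    simp only [hf] at h4
    rw [← h4]
    field_simp
    ring
end
end

section
/- For every smooth function k : ℝ → ℝ there exists a smooth curve γ : ℝ → ℝ³ with ⟨γ',γ'⟩ = 0, γ' future-directed, ⟨γ'',γ''⟩ = 1, whose curvature (1/4)⟨γ''',γ'''⟩ equals k. -/
noncomputable section

open MeasureTheory intervalIntegral in
theorem weight_bound (a P : ℝ → ℝ) (ha : Continuous a) (ha0 : ∀ t, 0 ≤ a t)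
    (hP : ∀ x, HasDerivAt P (a x) x) (hP0 : P 0 = 0) (t : ℝ) :
    |∫ s in (0:ℝ)..t, a s * Real.exp (2 * |P s|)| ≤ Real.exp (2 * |P t|) / 2 := by
  have hPc : Continuous P := continuous_iff_continuousAt.2 fun x => (hP x).continuousAt
  have hmono : Monotone P := monotone_of_hasDerivAt_nonneg hP ha0
  rcases le_total 0 t with ht | ht
  · have h1 : ∫ s in (0:ℝ)..t, a s * Real.exp (2 * |P s|)
        = ∫ s in (0:ℝ)..t, a s * Real.exp (2 * P s) := by
      apply integral_congr
      intro s hs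
      rw [Set.uIcc_of_le ht] at hs
      have : 0 ≤ P s := hP0 ▸ hmono hs.1
      simp only [abs_of_nonneg this]
    have h2 : ∫ s in (0:ℝ)..t, a s * Real.exp (2 * P s)
        = Real.exp (2 * P t) / 2 - Real.exp (2 * P 0) / 2 := by
      apply integral_eq_sub_of_hasDerivAt (f := fun s => Real.exp (2 * P s) / 2)
      · intro x _
        have := (((hP x).const_mul 2).exp).div_const 2
        refine this.congr_deriv ?_
        ring
      · exact Continuous.intervalIntegrable (by fun_prop) _ _
    have h3 : 0 ≤ P t := hP0 ▸ hmono ht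
    rw [h1, h2, hP0, abs_of_nonneg h3, abs_of_nonneg]
    · simp
    · have := Real.one_le_exp (x := 2 * P t) (by linarith)
      simp; linarith
  · have h1 : ∫ s in (0:ℝ)..t, a s * Real.exp (2 * |P s|)
        = ∫ s in (0:ℝ)..t, a s * Real.exp (-2 * P s) := by
      apply integral_congr
      intro s hs
      rw [Set.uIcc_of_ge ht] at hs
      have : P s ≤ 0 := hP0 ▸ hmono hs.2
      simp only [abs_of_nonpos this]
      ring_nf
    have h2 : ∫ s in (0:ℝ)..t, a s * Real.exp (-2 * P s)
        = -Real.exp (-2 * P t) / 2 - -Real.exp (-2 * P 0) / 2 := by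
      apply integral_eq_sub_of_hasDerivAt (f := fun s => -Real.exp (-2 * P s) / 2)
      · intro x _
        have := (((hP x).const_mul (-2)).exp).neg.div_const 2
        refine this.congr_deriv ?_
        ring
      · exact Continuous.intervalIntegrable (by fun_prop) _ _
    have h3 : P t ≤ 0 := hP0 ▸ hmono ht
    have h4 : 2 * -P t = -2 * P t := by ring
    have := Real.one_le_exp (x := -2 * P t) (by linarith)
    rw [h1, h2, hP0, abs_of_nonpos h3, abs_of_nonpos, h4]
    · simp; linarith
    · rw [mul_zero, Real.exp_zero]; linarith

open MeasureTheory intervalIntegral BoundedContinuousFunction in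
theorem linear_ode {E : Type} [NormedAddCommGroup E] [NormedSpace ℝ E] [CompleteSpace E]
    (A : ℝ → E →L[ℝ] E) (hA : Continuous A) (x0 : E) :
    ∃ y : ℝ → E, y 0 = x0 ∧ ∀ t, HasDerivAt y (A t (y t)) t := by
  have han : Continuous fun t => ‖A t‖ := hA.norm
  obtain ⟨P, hP, hP0⟩ : ∃ P : ℝ → ℝ, (∀ x, HasDerivAt P (‖A x‖) x) ∧ P 0 = 0 :=
    ⟨fun s => ∫ u in (0:ℝ)..s, ‖A u‖, fun x => (han.integral_hasStrictDerivAt 0 x).hasDerivAt,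
      by simp⟩
  have hPc : Continuous P := continuous_iff_continuousAt.2 fun x => (hP x).continuousAt
  obtain ⟨w, hw⟩ : ∃ w : ℝ → ℝ, w = fun t => Real.exp (2 * |P t|) := ⟨_, rfl⟩
  have hwc : Continuous w := by rw [hw]; fun_prop
  have hw1 : ∀ t, 1 ≤ w t := fun t => by rw [hw]; exact Real.one_le_exp (by positivity)
  have hw0 : ∀ t, 0 < w t := fun t => lt_of_lt_of_le one_pos (hw1 t)
  have hwb : ∀ t, |∫ s in (0:ℝ)..t, ‖A s‖ * w s| ≤ w t / 2 := fun t => by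
    rw [hw]; exact weight_bound _ P han (fun _ => norm_nonneg _) hP hP0 t
  have hcont : ∀ z : ℝ →ᵇ E, Continuous fun s => A s (w s • z s) := fun z =>
    hA.clm_apply (hwc.smul z.continuous)
  have key : ∀ (z : ℝ → E) (C : ℝ), (∀ s, ‖z s‖ ≤ C) → ∀ t,
      ‖∫ s in (0:ℝ)..t, A s (w s • z s)‖ ≤ C * (w t / 2) := by
    intro z C hC t
    have hC0 : 0 ≤ C := (norm_nonneg _).trans (hC 0)
    have h1 : ‖∫ s in (0:ℝ)..t, A s (w s • z s)‖ ≤ |∫ s in (0:ℝ)..t, C * (‖A s‖ * w s)| := by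
      apply norm_integral_le_abs_of_norm_le
      · refine Filter.Eventually.of_forall fun s => ?_
        calc ‖A s (w s • z s)‖ ≤ ‖A s‖ * ‖w s • z s‖ := (A s).le_opNorm _
          _ = ‖A s‖ * w s * ‖z s‖ := by
              rw [norm_smul, Real.norm_of_nonneg (hw0 s).le, mul_assoc]
          _ ≤ ‖A s‖ * w s * C := mul_le_mul_of_nonneg_left (hC s)
              (mul_nonneg (norm_nonneg _) (hw0 s).le)
          _ = C * (‖A s‖ * w s) := by ring
      · exact Continuous.intervalIntegrable (by fun_prop) _ _
    rw [intervalIntegral.integral_const_mul, abs_mul, abs_of_nonneg hC0] at h1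
    exact h1.trans (mul_le_mul_of_nonneg_left (hwb t) hC0)
  let S : (ℝ →ᵇ E) → (ℝ →ᵇ E) := fun z =>
    BoundedContinuousFunction.ofNormedAddCommGroup
      (fun t => (w t)⁻¹ • (x0 + ∫ s in (0:ℝ)..t, A s (w s • z s)))
      (by
        have h1 : Continuous fun t => (w t)⁻¹ := hwc.inv₀ fun t => (hw0 t).ne'
        have h2 : Continuous fun t => ∫ s in (0:ℝ)..t, A s (w s • z s) :=
          continuous_primitive (fun a b => (hcont z).intervalIntegrable a b) 0
        exact h1.smul (continuous_const.add h2))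
      (‖x0‖ + ‖z‖)
      (by
        intro t
        have h1 := key z ‖z‖ z.norm_coe_le_norm t
        rw [norm_smul, norm_inv, Real.norm_of_nonneg (hw0 t).le, inv_mul_le_iff₀ (hw0 t)]
        have h2 := norm_add_le x0 (∫ s in (0:ℝ)..t, A s (w s • z s))
        nlinarith [hw1 t, norm_nonneg x0, norm_nonneg z, hw0 t])
  have hS : ∀ z t, S z t = (w t)⁻¹ • (x0 + ∫ s in (0:ℝ)..t, A s (w s • z s)) := fun _ _ => rfl
  have hcontr : ContractingWith (1/2) S := by
    refine ⟨by rw [← NNReal.coe_lt_coe]; norm_num, LipschitzWith.of_dist_le_mul fun z z' => ?_⟩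
    rw [BoundedContinuousFunction.dist_le (by positivity)]
    intro t
    have h1 := key (fun s => z s - z' s) (dist z z')
      (fun s => by rw [← dist_eq_norm]; exact BoundedContinuousFunction.dist_coe_le_dist s) t
    have h2 : ∫ s in (0:ℝ)..t, A s (w s • (z s - z' s))
        = (∫ s in (0:ℝ)..t, A s (w s • z s)) - ∫ s in (0:ℝ)..t, A s (w s • z' s) := by
      rw [← integral_sub ((hcont z).intervalIntegrable _ _) ((hcont z').intervalIntegrable _ _)]
      simp only [smul_sub, map_sub]
    rw [dist_eq_norm, hS, hS, ← smul_sub, add_sub_add_left_eq_sub, ← h2, norm_smul, norm_inv,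
      Real.norm_of_nonneg (hw0 t).le, inv_mul_le_iff₀ (hw0 t)]
    refine h1.trans (le_of_eq ?_)
    push_cast
    ring
  obtain ⟨z, hz⟩ : ∃ z, S z = z := ⟨_, hcontr.fixedPoint_isFixedPt⟩
  have hy : ∀ t, w t • z t = x0 + ∫ s in (0:ℝ)..t, A s (w s • z s) := by
    intro t
    have := hS z t
    rw [hz] at this
    conv_lhs => rw [this]
    rw [smul_inv_smul₀ (hw0 t).ne']
  refine ⟨fun t => w t • z t, by simp [hy 0], fun t => ?_⟩
  have h1 := ((hcont z).integral_hasStrictDerivAt 0 t).hasDerivAt.const_add x0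
  exact h1.congr_of_eventuallyEq (Filter.Eventually.of_forall hy)

theorem smooth_of_deriv {E : Type} [NormedAddCommGroup E] [NormedSpace ℝ E]
    (y : ℝ → E) (g : ℝ → E) (hy : ∀ t, HasDerivAt y (g t) t)
    (hg : ∀ n : ℕ, ContDiff ℝ n y → ContDiff ℝ n g) : ContDiff ℝ (⊤ : ℕ∞) y := by
  have hd : deriv y = g := funext fun t => (hy t).deriv
  have hdiff : Differentiable ℝ y := fun t => (hy t).differentiableAt
  rw [contDiff_infty]
  intro n
  induction n with
  | zero => exact contDiff_zero.2 hdiff.continuous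
  | succ n ih =>
    push_cast
    rw [contDiff_succ_iff_deriv]
    refine ⟨hdiff, by simp, ?_⟩
    rw [hd]
    exact hg n ih

theorem hill (k : ℝ → ℝ) (hk : ContDiff ℝ (⊤ : ℕ∞) k) (u v : ℝ) :
    ∃ a a' : ℝ → ℝ, a 0 = u ∧ a' 0 = v ∧ (∀ t, HasDerivAt a (a' t) t) ∧
      (∀ t, HasDerivAt a' (-k t * a t) t) ∧ ContDiff ℝ (⊤ : ℕ∞) a := by
  let A : ℝ → (ℝ × ℝ) →L[ℝ] (ℝ × ℝ) := fun t =>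
    (ContinuousLinearMap.inl ℝ ℝ ℝ).comp (ContinuousLinearMap.snd ℝ ℝ ℝ)
      + (-k t) • (ContinuousLinearMap.inr ℝ ℝ ℝ).comp (ContinuousLinearMap.fst ℝ ℝ ℝ)
  have hkc := hk.continuous
  have hA : Continuous A := continuous_const.add (hkc.neg.smul continuous_const)
  obtain ⟨y, hy0, hy⟩ := linear_ode A hA (u, v)
  have hAy : ∀ t, A t (y t) = ((y t).2, -k t * (y t).1) := fun t => by
    simp [A]
  simp only [hAy] at hy
  have hs : ContDiff ℝ (⊤ : ℕ∞) y := by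
    refine smooth_of_deriv y _ hy fun n hn => ?_
    have hkn : ContDiff ℝ n k := hk.of_le (by exact_mod_cast le_top)
    exact hn.snd.prodMk (hkn.neg.mul hn.fst)
  refine ⟨fun t => (y t).1, fun t => (y t).2, by simp [hy0], by simp [hy0], fun t => ?_,
    fun t => ?_, hs.fst⟩
  · exact (hasFDerivAt_fst.comp_hasDerivAt t (hy t))
  · exact (hasFDerivAt_snd.comp_hasDerivAt t (hy t))

theorem hasDerivAt_vec3 {f g h : ℝ → ℝ} {f' g' h' t : ℝ} (hf : HasDerivAt f f' t)
    (hg : HasDerivAt g g' t) (hh : HasDerivAt h h' t) :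
    HasDerivAt (fun t => ![f t, g t, h t]) ![f', g', h'] t := by
  rw [hasDerivAt_pi]
  intro i
  fin_cases i
  · exact hf
  · exact hg
  · exact hh

/-- every smooth function `k : ℝ → ℝ` is the curvature of some pseudo-arc
parametrized null curve in Minkowski 3-space. -/
theorem stmt3 (k : ℝ → ℝ) (hk : ContDiff ℝ (⊤ : ℕ∞) k) :
    ∃ γ : ℝ → Fin 3 → ℝ, ContDiff ℝ (⊤ : ℕ∞) γ ∧
      (∀ s, mink (deriv γ s) (deriv γ s) = 0) ∧
      (∀ s, mink (deriv γ s) ![1, 0, 1] < 0) ∧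
      (∀ s, mink (deriv (deriv γ) s) (deriv (deriv γ) s) = 1) ∧
      (∀ s, (1/4) * mink (deriv (deriv (deriv γ)) s) (deriv (deriv (deriv γ)) s) = k s) := by
  obtain ⟨r, hr⟩ : ∃ r : ℝ, r ^ 2 = 2 := ⟨√2, by norm_num⟩
  obtain ⟨a, a', ha0, ha0', ha, ha', has⟩ := hill k hk 1 0
  obtain ⟨b, b', hb0, hb0', hb, hb', hbs⟩ := hill k hk 0 (r / 2)
  have hW : ∀ t, a t * b' t - a' t * b t = r / 2 := by
    have h1 : ∀ t, HasDerivAt (fun t => a t * b' t - a' t * b t) 0 t := fun t => by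
      refine (((ha t).mul (hb' t)).sub ((ha' t).mul (hb t))).congr_deriv ?_
      ring
    intro t
    have := is_const_of_deriv_eq_zero (fun t => (h1 t).differentiableAt)
      (fun t => (h1 t).deriv) t 0
    simpa [ha0, ha0', hb0, hb0'] using this
  have hW2 : ∀ t, (a t * b' t - a' t * b t) ^ 2 = 1 / 2 := fun t => by
    rw [hW t, div_pow, hr]; norm_num
  have hac := has.continuous
  have hbc := hbs.continuous
  have c1 : Continuous fun t => a t ^ 2 := by fun_prop
  have c2 : Continuous fun t => r * (a t * b t) := by fun_prop
  have c3 : Continuous fun t => b t ^ 2 := by fun_prop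
  let γ : ℝ → Fin 3 → ℝ := fun t =>
    ![∫ s in (0:ℝ)..t, a s ^ 2, ∫ s in (0:ℝ)..t, r * (a s * b s), ∫ s in (0:ℝ)..t, b s ^ 2]
  have h1 : ∀ t, HasDerivAt γ ![a t ^ 2, r * (a t * b t), b t ^ 2] t := fun t =>
    hasDerivAt_vec3 (c1.integral_hasStrictDerivAt 0 t).hasDerivAt
      (c2.integral_hasStrictDerivAt 0 t).hasDerivAt (c3.integral_hasStrictDerivAt 0 t).hasDerivAt
  have d1 : deriv γ = fun t => ![a t ^ 2, r * (a t * b t), b t ^ 2] :=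
    funext fun t => (h1 t).deriv
  have d2 : deriv (deriv γ) = fun t =>
      ![2 * (a t * a' t), r * (a' t * b t + a t * b' t), 2 * (b t * b' t)] := by
    rw [d1]
    refine funext fun t => HasDerivAt.deriv (hasDerivAt_vec3 ?_ ?_ ?_)
    · exact ((ha t).pow 2).congr_deriv (by push_cast; ring)
    · exact ((ha t).mul (hb t)).const_mul r
    · exact ((hb t).pow 2).congr_deriv (by push_cast; ring)
  have d3 : deriv (deriv (deriv γ)) = fun t =>
      ![2 * (a' t * a' t + a t * (-k t * a t)),
        r * ((-k t * a t * b t + a' t * b' t) + (a' t * b' t + a t * (-k t * b t))),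
        2 * (b' t * b' t + b t * (-k t * b t))] := by
    rw [d2]
    refine funext fun t => HasDerivAt.deriv (hasDerivAt_vec3 ?_ ?_ ?_)
    · exact ((ha t).mul (ha' t)).const_mul 2
    · exact (((ha' t).mul (hb t)).add ((ha t).mul (hb' t))).const_mul r
    · exact ((hb t).mul (hb' t)).const_mul 2
  refine ⟨γ, ?_, fun s => ?_, fun s => ?_, fun s => ?_, fun s => ?_⟩
  · refine smooth_of_deriv γ _ h1 fun n _ => ?_
    have han : ContDiff ℝ n a := has.of_le (by exact_mod_cast le_top)
    have hbn : ContDiff ℝ n b := hbs.of_le (by exact_mod_cast le_top)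
    rw [contDiff_pi]
    intro i
    fin_cases i
    · exact han.pow 2
    · exact contDiff_const.mul (han.mul hbn)
    · exact hbn.pow 2
  · simp only [d1, mink, Matrix.cons_val]
    linear_combination (a s * b s) ^ 2 * hr
  · simp only [d1, mink, Matrix.cons_val]
    have : a s ≠ 0 ∨ b s ≠ 0 := by
      by_contra! h
      have := hW2 s
      rw [h.1, h.2] at this
      norm_num at this
    rcases this with h | h
    · have := pow_pos (abs_pos.2 h) 2
      rw [sq_abs] at this
      nlinarith [sq_nonneg (b s)]
    · have := pow_pos (abs_pos.2 h) 2
      rw [sq_abs] at this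
      nlinarith [sq_nonneg (a s)]
  · simp only [d2, mink, Matrix.cons_val]
    linear_combination (a' s * b s + a s * b' s) ^ 2 * hr + 2 * hW2 s
  · simp only [d3, mink, Matrix.cons_val]
    linear_combination (1/4) * ((-k s * a s * b s + a' s * b' s) + (a' s * b' s + a s * (-k s * b s))) ^ 2 * hr + 2 * k s * hW2 s
end
end

section
/- Let Γ : ℝ × J → ℝ³ (J an open interval) be a smooth map such that each curve Γ(·,t) is a pseudo-arc parametrized null curve; let κ(s,t) be its curvature and (t,n,b)(s,t) its Frenet frame, and write ∂Γ/∂t = p₁ t + p₂ n + p₃ b with smooth coefficient functions p₁, p₂, p₃. Then necessarily p₂ = −∂p₃/∂s and ∂p₁/∂s = (1/2)∂³p₃/∂s³ + (∂κ/∂s)·p₃; in particular p₁(s,t) = (1/2)∂²p₃/∂s²(s,t) + ∫₀ˢ (∂κ/∂s)(u,t) p₃(u,t) du + c(t) for some function c(t). -/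
noncomputable section

/-- Partial derivative in the first (space) variable, vector-valued. -/
def dsV (f : ℝ → ℝ → Fin 3 → ℝ) : ℝ → ℝ → Fin 3 → ℝ := fun s t => deriv (fun x => f x t) s

/-- Partial derivative in the second (time) variable, vector-valued. -/
def dtV (f : ℝ → ℝ → Fin 3 → ℝ) : ℝ → ℝ → Fin 3 → ℝ := fun s t => deriv (fun x => f s x) t

/-- Partial derivative in the first (space) variable, scalar-valued. -/
def dsR (f : ℝ → ℝ → ℝ) : ℝ → ℝ → ℝ := fun s t => deriv (fun x => f x t) s

theorem mink_comm' (x y : Fin 3 → ℝ) : mink x y = mink y x := by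
  unfold mink; ring

theorem mink_hasDerivAt {x y : ℝ → Fin 3 → ℝ} {x' y' : Fin 3 → ℝ} {s : ℝ}
    (hx : HasDerivAt x x' s) (hy : HasDerivAt y y' s) :
    HasDerivAt (fun u => mink (x u) (y u)) (mink x' (y s) + mink (x s) y') s := by
  rw [hasDerivAt_pi] at hx hy
  unfold mink
  have h := ((((hx 0).mul (hy 2)).add ((hx 2).mul (hy 0))).neg).add ((hx 1).mul (hy 1))
  refine HasDerivAt.congr_deriv (h.congr_of_eventuallyEq ?_) ?_
  · exact Filter.Eventually.of_forall fun u => by simp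
  · ring

theorem mink_lin (x a b c : Fin 3 → ℝ) (p q r k : ℝ) :
    mink x (p • a + q • b + r • (c + k • a)) =
      p * mink x a + q * mink x b + r * (mink x c + k * mink x a) := by
  simp [mink]; ring

theorem smooth_step {E : Type*} [NormedAddCommGroup E] [NormedSpace ℝ E] {f : ℝ → E}
    (hf : ContDiff ℝ (⊤ : ℕ∞) f) : ContDiff ℝ (⊤ : ℕ∞) (deriv f) := by
  exact (contDiff_infty_iff_deriv.1 hf).2

theorem smooth_hd {E : Type*} [NormedAddCommGroup E] [NormedSpace ℝ E] {f : ℝ → E}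
    (hf : ContDiff ℝ (⊤ : ℕ∞) f) (s : ℝ) : HasDerivAt f (deriv f s) s :=
  ((contDiff_infty_iff_deriv.1 hf).1 s).hasDerivAt

theorem one_var (g V : ℝ → Fin 3 → ℝ) (k p q r : ℝ → ℝ)
    (hg : ContDiff ℝ (⊤ : ℕ∞) g) (hV : ContDiff ℝ (⊤ : ℕ∞) V)
    (hp : ContDiff ℝ (⊤ : ℕ∞) p) (hq : ContDiff ℝ (⊤ : ℕ∞) q) (hr : ContDiff ℝ (⊤ : ℕ∞) r)
    (h0 : ∀ s, mink (deriv g s) (deriv g s) = 0)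
    (h1 : ∀ s, mink (deriv (deriv g) s) (deriv (deriv g) s) = 1)
    (hk : ∀ s, k s = (1/4) * mink (deriv (deriv (deriv g)) s) (deriv (deriv (deriv g)) s))
    (hVe : ∀ s, V s = p s • deriv g s + q s • deriv (deriv g) s +
      r s • (deriv (deriv (deriv g)) s + (2 * k s) • deriv g s))
    (hV1 : ∀ s, mink (deriv g s) (deriv V s) = 0)
    (hV2 : ∀ s, mink (deriv (deriv g) s) (deriv (deriv V) s) = 0) :
    ContDiff ℝ (⊤ : ℕ∞) k ∧ (∀ s, q s = - deriv r s) ∧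
    (∀ s, deriv p s = (1/2) * deriv (deriv (deriv r)) s + deriv k s * r s) := by
  have s1 := smooth_step hg
  have s2 := smooth_step s1
  have s3 := smooth_step s2
  have sV := smooth_step hV
  set g1 := deriv g
  set g2 := deriv g1
  set g3 := deriv g2
  set g4 := deriv g3
  have ck : ContDiff ℝ (⊤ : ℕ∞) k := by
    have : k = fun s => (1/4) * mink (g3 s) (g3 s) := funext hk
    rw [this]
    unfold mink
    have := contDiff_pi.1 s3
    have a := this 0
    have b := this 1
    have c := this 2
    fun_prop
  have key : ∀ {x y : ℝ → Fin 3 → ℝ} {f : ℝ → ℝ} {f' : ℝ} {s : ℝ},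
      ContDiff ℝ (⊤ : ℕ∞) x → ContDiff ℝ (⊤ : ℕ∞) y → (∀ u, mink (x u) (y u) = f u) →
      HasDerivAt f f' s → mink (deriv x s) (y s) + mink (x s) (deriv y s) = f' := by
    intro x y f f' s hx hy h hf
    have h2 := mink_hasDerivAt (smooth_hd hx s) (smooth_hd hy s)
    rw [show (fun u => mink (x u) (y u)) = f from funext h] at h2
    exact h2.unique hf
  have e12 : ∀ s, mink (g1 s) (g2 s) = 0 := fun s => by
    have := key s1 s1 h0 (hasDerivAt_const s 0)
    rw [mink_comm' (deriv g1 s)] at this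
    change mink (g1 s) (g2 s) + mink (g1 s) (g2 s) = 0 at this
    linarith
  have e23 : ∀ s, mink (g2 s) (g3 s) = 0 := fun s => by
    have := key s2 s2 h1 (hasDerivAt_const s 1)
    rw [mink_comm' (deriv g2 s)] at this
    change mink (g2 s) (g3 s) + mink (g2 s) (g3 s) = 0 at this
    linarith
  have e13 : ∀ s, mink (g1 s) (g3 s) = -1 := fun s => by
    have := key s1 s2 e12 (hasDerivAt_const s 0)
    change mink (g2 s) (g2 s) + mink (g1 s) (g3 s) = 0 at this
    linarith [h1 s]
  have e33 : ∀ s, mink (g3 s) (g3 s) = 4 * k s := fun s => by rw [hk]; ring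
  have e14 : ∀ s, mink (g4 s) (g1 s) = 0 := fun s => by
    have := key s1 s3 e13 (hasDerivAt_const s (-1))
    change mink (g2 s) (g3 s) + mink (g1 s) (g4 s) = 0 at this
    rw [mink_comm']
    linarith [e23 s]
  have e24 : ∀ s, mink (g4 s) (g2 s) = - 4 * k s := fun s => by
    have := key s2 s3 e23 (hasDerivAt_const s 0)
    change mink (g3 s) (g3 s) + mink (g2 s) (g4 s) = 0 at this
    rw [mink_comm']
    linarith [e33 s]
  have e34 : ∀ s, mink (g4 s) (g3 s) = 2 * deriv k s := fun s => by
    have := key s3 s3 e33 ((smooth_hd ck s).const_mul 4)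
    change mink (g4 s) (g3 s) + mink (g3 s) (g4 s) = _ at this
    rw [mink_comm' (g3 s)] at this
    linarith
  have f1 : ∀ s, mink (g1 s) (V s) = - r s := fun s => by
    rw [hVe, mink_lin, h0, e12, e13]; ring
  have f2 : ∀ s, mink (g2 s) (V s) = q s := fun s => by
    rw [hVe, mink_lin, mink_comm' _ (g1 s), e12, h1, e23]; ring
  have f3 : ∀ s, mink (g3 s) (V s) = - p s + 2 * (k s * r s) := fun s => by
    rw [hVe, mink_lin, mink_comm' _ (g1 s), mink_comm' _ (g2 s), e13, e23, e33]; ring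
  have f4 : ∀ s, mink (g4 s) (V s) = - 4 * k s * q s + 2 * deriv k s * r s := fun s => by
    rw [hVe, mink_lin, e14, e24, e34]; ring
  have hqr : ∀ s, q s = - deriv r s := fun s => by
    have := key s1 hV f1 (smooth_hd hr s).neg
    change mink (g2 s) (V s) + _ = _ at this
    rw [f2, hV1] at this
    linarith
  have hkr : ∀ s, HasDerivAt (fun u => - p u + 2 * (k u * r u))
      (- deriv p s + 2 * (deriv k s * r s + k s * deriv r s)) s := fun s =>
    (smooth_hd hp s).neg.add (((smooth_hd ck s).mul (smooth_hd hr s)).const_mul 2)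
  refine ⟨ck, hqr, fun s => ?_⟩
  have f2' : ∀ s, mink (g2 s) (deriv V s) = deriv q s - (- p s + 2 * (k s * r s)) := fun s => by
    have := key s2 hV f2 (smooth_hd hq s)
    change mink (g3 s) (V s) + _ = _ at this
    rw [f3] at this
    linarith
  have A := key s2 sV f2' ((smooth_hd (smooth_step hq) s).sub (hkr s))
  change mink (g3 s) _ + _ = _ at A
  rw [hV2] at A
  have C := key s3 hV f3 (hkr s)
  change mink (g4 s) (V s) + _ = _ at C
  rw [f4] at C
  have hq2 : deriv (deriv q) s = - deriv (deriv (deriv r)) s := by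
    rw [show q = fun u => - deriv r u from funext hqr]
    have : deriv (fun u => - deriv r u) = fun u => - deriv (deriv r) u := by
      funext u; exact deriv.fun_neg
    rw [this]; exact deriv.fun_neg
  rw [hqr s] at C
  rw [hq2] at A
  linarith

section two
variable {E : Type*} [NormedAddCommGroup E] [NormedSpace ℝ E] {J : Set ℝ} {f : ℝ → ℝ → E}

theorem two_nhds (hJ : IsOpen J) {s t : ℝ} (ht : t ∈ J) :
    (Set.univ ×ˢ J : Set (ℝ × ℝ)) ∈ nhds (s, t) :=
  (isOpen_univ.prod hJ).mem_nhds ⟨trivial, ht⟩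

theorem two_slice (hJ : IsOpen J)
    (hf : ContDiffOn ℝ (⊤ : ℕ∞) (fun p : ℝ × ℝ => f p.1 p.2) (Set.univ ×ˢ J)) {t : ℝ}
    (ht : t ∈ J) : ContDiff ℝ (⊤ : ℕ∞) (fun x => f x t) := by
  rw [contDiff_iff_contDiffAt]
  intro s
  exact (hf.contDiffAt (two_nhds hJ ht)).comp (f := fun x : ℝ => (x, t)) s
    (by fun_prop)

theorem two_hs (hJ : IsOpen J) 
    (hf : ContDiffOn ℝ (⊤ : ℕ∞) (fun p : ℝ × ℝ => f p.1 p.2) (Set.univ ×ˢ J)) {s t : ℝ}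
    (ht : t ∈ J) : HasDerivAt (fun x => f x t)
      (fderiv ℝ (fun p : ℝ × ℝ => f p.1 p.2) (s, t) (1, 0)) s := by
  have h := ((hf.contDiffAt (two_nhds hJ (s := s) ht)).differentiableAt (by simp)).hasFDerivAt
  exact h.comp_hasDerivAt (f := fun x : ℝ => (x, t)) s
    ((hasDerivAt_id s).prodMk (hasDerivAt_const s t))

theorem two_ht (hJ : IsOpen J) 
    (hf : ContDiffOn ℝ (⊤ : ℕ∞) (fun p : ℝ × ℝ => f p.1 p.2) (Set.univ ×ˢ J)) {s t : ℝ}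
    (ht : t ∈ J) : HasDerivAt (fun x => f s x)
      (fderiv ℝ (fun p : ℝ × ℝ => f p.1 p.2) (s, t) (0, 1)) t := by
  have h := ((hf.contDiffAt (two_nhds hJ (s := s) ht)).differentiableAt (by simp)).hasFDerivAt
  exact h.comp_hasDerivAt (f := fun x : ℝ => (s, x)) t
    ((hasDerivAt_const t s).prodMk (hasDerivAt_id t))

theorem two_fd (hJ : IsOpen J) 
    (hf : ContDiffOn ℝ (⊤ : ℕ∞) (fun p : ℝ × ℝ => f p.1 p.2) (Set.univ ×ˢ J)) :
    ContDiffOn ℝ (⊤ : ℕ∞) (fderiv ℝ (fun p : ℝ × ℝ => f p.1 p.2)) (Set.univ ×ˢ J) :=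
  hf.fderiv_of_isOpen (isOpen_univ.prod hJ) (by simp)

theorem two_ds (hJ : IsOpen J) 
    (hf : ContDiffOn ℝ (⊤ : ℕ∞) (fun p : ℝ × ℝ => f p.1 p.2) (Set.univ ×ˢ J)) :
    ContDiffOn ℝ (⊤ : ℕ∞) (fun p : ℝ × ℝ => deriv (fun x => f x p.2) p.1) (Set.univ ×ˢ J) :=
  ((two_fd hJ hf).clm_apply (contDiffOn_const (c := ((1 : ℝ), (0 : ℝ))))).congr
    fun p hp => (two_hs hJ hf hp.2).deriv

theorem two_dt (hJ : IsOpen J) 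
    (hf : ContDiffOn ℝ (⊤ : ℕ∞) (fun p : ℝ × ℝ => f p.1 p.2) (Set.univ ×ˢ J)) :
    ContDiffOn ℝ (⊤ : ℕ∞) (fun p : ℝ × ℝ => deriv (fun x => f p.1 x) p.2) (Set.univ ×ˢ J) :=
  ((two_fd hJ hf).clm_apply (contDiffOn_const (c := ((0 : ℝ), (1 : ℝ))))).congr
    fun p hp => (two_ht hJ hf hp.2).deriv

theorem two_symm (hJ : IsOpen J) 
    (hf : ContDiffOn ℝ (⊤ : ℕ∞) (fun p : ℝ × ℝ => f p.1 p.2) (Set.univ ×ˢ J)) {s t : ℝ}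
    (ht : t ∈ J) : deriv (fun y => deriv (fun x => f x y) s) t =
      deriv (fun x => deriv (fun y => f x y) t) s := by
  set F := fun p : ℝ × ℝ => f p.1 p.2 with hF
  have hd := (((two_fd hJ hf).contDiffAt (two_nhds hJ (s := s) ht)).differentiableAt
    (by simp)).hasFDerivAt
  have hsym : IsSymmSndFDerivAt ℝ F (s, t) :=
    (hf.contDiffAt (two_nhds hJ (s := s) ht)).isSymmSndFDerivAt (by simp; exact WithTop.coe_le_coe.2 (le_top : (2 : ℕ∞) ≤ ⊤))
  have a : HasDerivAt (fun y => fderiv ℝ F (s, y) (1, 0))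
      (fderiv ℝ (fderiv ℝ F) (s, t) (0, 1) (1, 0)) t := by
    have := hd.comp_hasDerivAt (f := fun x : ℝ => (s, x)) t
      ((hasDerivAt_const t s).prodMk (hasDerivAt_id t))
    simpa using this.clm_apply (hasDerivAt_const t ((1 : ℝ), (0 : ℝ)))
  have b : HasDerivAt (fun x => fderiv ℝ F (x, t) (0, 1))
      (fderiv ℝ (fderiv ℝ F) (s, t) (1, 0) (0, 1)) s := by
    have := hd.comp_hasDerivAt (f := fun x : ℝ => (x, t)) s
      ((hasDerivAt_id s).prodMk (hasDerivAt_const s t))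
    simpa using this.clm_apply (hasDerivAt_const s ((0 : ℝ), (1 : ℝ)))
  have a' := a.congr_of_eventuallyEq (f₁ := fun y => deriv (fun x => f x y) s)
    (Filter.eventually_of_mem (hJ.mem_nhds ht) fun y hy => (two_hs hJ hf hy).deriv)
  have b' := b.congr_of_eventuallyEq (f₁ := fun x => deriv (fun y => f x y) t)
    (Filter.Eventually.of_forall fun x => (two_ht hJ hf ht).deriv)
  rw [a'.deriv, b'.deriv]
  exact hsym _ _

end two

/-- for a motion of pseudo-arc parametrized null curves with variation field
`∂Γ/∂t = p₁ t + p₂ n + p₃ b`, necessarily `p₂ = -∂p₃/∂s`,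
`∂p₁/∂s = (1/2)∂³p₃/∂s³ + (∂κ/∂s) p₃`, and hence
`p₁ = (1/2)∂²p₃/∂s² + ∫₀ˢ (∂κ/∂s) p₃ du + c(t)`. -/
theorem stmt5 (J : Set ℝ) (hJopen : IsOpen J) (hJconn : J.OrdConnected)
    (Γ : ℝ → ℝ → Fin 3 → ℝ)
    (hΓ : ContDiffOn ℝ (⊤ : ℕ∞) (fun p : ℝ × ℝ => Γ p.1 p.2) (Set.univ ×ˢ J))
    (hnull : ∀ s : ℝ, ∀ t ∈ J, mink (dsV Γ s t) (dsV Γ s t) = 0)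
    (hfut : ∀ s : ℝ, ∀ t ∈ J, mink (dsV Γ s t) ![1, 0, 1] < 0)
    (hpa : ∀ s : ℝ, ∀ t ∈ J, mink (dsV (dsV Γ) s t) (dsV (dsV Γ) s t) = 1)
    (κ : ℝ → ℝ → ℝ)
    (hκ : ∀ s t, κ s t = (1/4) * mink (dsV (dsV (dsV Γ)) s t) (dsV (dsV (dsV Γ)) s t))
    (T N B : ℝ → ℝ → Fin 3 → ℝ)
    (hT : ∀ s t, T s t = dsV Γ s t)
    (hN : ∀ s t, N s t = dsV (dsV Γ) s t)
    (hB : ∀ s t, B s t = dsV (dsV (dsV Γ)) s t + (2 * κ s t) • dsV Γ s t)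
    (p₁ p₂ p₃ : ℝ → ℝ → ℝ)
    (hp₁ : ContDiffOn ℝ (⊤ : ℕ∞) (fun p : ℝ × ℝ => p₁ p.1 p.2) (Set.univ ×ˢ J))
    (hp₂ : ContDiffOn ℝ (⊤ : ℕ∞) (fun p : ℝ × ℝ => p₂ p.1 p.2) (Set.univ ×ˢ J))
    (hp₃ : ContDiffOn ℝ (⊤ : ℕ∞) (fun p : ℝ × ℝ => p₃ p.1 p.2) (Set.univ ×ˢ J))
    (hmotion : ∀ s : ℝ, ∀ t ∈ J,
      dtV Γ s t = p₁ s t • T s t + p₂ s t • N s t + p₃ s t • B s t) :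
    (∀ s : ℝ, ∀ t ∈ J, p₂ s t = -dsR p₃ s t) ∧
    (∀ s : ℝ, ∀ t ∈ J,
      dsR p₁ s t = (1/2) * dsR (dsR (dsR p₃)) s t + dsR κ s t * p₃ s t) ∧
    (∃ c : ℝ → ℝ, ∀ s : ℝ, ∀ t ∈ J,
      p₁ s t = (1/2) * dsR (dsR p₃) s t + (∫ u in (0:ℝ)..s, dsR κ u t * p₃ u t) + c t) := by
  have c1 := two_ds hJopen hΓ
  have c2 := two_ds (f := dsV Γ) hJopen c1
  have cV := two_dt hJopen hΓ
  have T1 : ∀ s, ∀ t ∈ J, dtV (dsV Γ) s t = dsV (dtV Γ) s t := fun s t ht =>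
    two_symm hJopen hΓ ht
  have T2 : ∀ s, ∀ t ∈ J, dtV (dsV (dsV Γ)) s t = dsV (dsV (dtV Γ)) s t := fun s t ht => by
    have h : dtV (dsV (dsV Γ)) s t = dsV (dtV (dsV Γ)) s t :=
      two_symm (f := dsV Γ) hJopen c1 ht
    rw [h]
    unfold dsV
    congr 1
    funext x
    exact T1 x t ht
  have D : ∀ (F : ℝ → ℝ → Fin 3 → ℝ) (c : ℝ),
      ContDiffOn ℝ (⊤ : ℕ∞) (fun p : ℝ × ℝ => F p.1 p.2) (Set.univ ×ˢ J) →
      (∀ s, ∀ t ∈ J, mink (F s t) (F s t) = c) →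
      ∀ s, ∀ t ∈ J, mink (F s t) (dtV F s t) = 0 := by
    intro F c hF h s t ht
    have h1 := (two_ht hJopen hF (s := s) ht)
    have h2 := h1.differentiableAt.hasDerivAt
    have h3 := mink_hasDerivAt h2 h2
    have h4 : HasDerivAt (fun u => mink (F s u) (F s u)) 0 t :=
      (hasDerivAt_const t c).congr_of_eventuallyEq
        (Filter.eventually_of_mem (hJopen.mem_nhds ht) fun y hy => h s y hy)
    have h5 := h3.unique h4
    rw [mink_comm' (deriv _ _)] at h5
    change mink (F s t) (dtV F s t) + mink (F s t) (dtV F s t) = 0 at h5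
    linarith
  have main : ∀ t ∈ J, _ := fun t ht => one_var (fun s => Γ s t) (fun s => dtV Γ s t)
    (fun s => κ s t) (fun s => p₁ s t) (fun s => p₂ s t) (fun s => p₃ s t)
    (two_slice hJopen hΓ ht) (two_slice (f := dtV Γ) hJopen cV ht) (two_slice hJopen hp₁ ht)
    (two_slice hJopen hp₂ ht) (two_slice hJopen hp₃ ht)
    (fun s => hnull s t ht) (fun s => hpa s t ht) (fun s => hκ s t)
    (fun s => by
      have := hmotion s t ht
      rw [hT, hN, hB] at this
      exact this)
    (fun s => by
      have := D (dsV Γ) 0 c1 hnull s t ht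
      rw [T1 s t ht] at this
      exact this)
    (fun s => by
      have := D (dsV (dsV Γ)) 1 c2 hpa s t ht
      rw [T2 s t ht] at this
      exact this)
  refine ⟨fun s t ht => (main t ht).2.1 s, fun s t ht => (main t ht).2.2 s,
    fun t => p₁ 0 t - (1/2) * dsR (dsR p₃) 0 t, fun s t ht => ?_⟩
  obtain ⟨hk, -, h⟩ := main t ht
  have hp := two_slice hJopen hp₁ ht
  have hr := two_slice hJopen hp₃ ht
  have hd : ∀ u, HasDerivAt (fun x => p₁ x t - (1/2) * dsR (dsR p₃) x t)
      (dsR κ u t * p₃ u t) u := fun u => by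
    have := (smooth_hd hp u).sub
      ((smooth_hd (smooth_step (smooth_step hr)) u).const_mul (1/2))
    refine HasDerivAt.congr_deriv this ?_
    rw [h u]
    change _ = deriv (fun x => κ x t) u * p₃ u t
    ring
  have hc : Continuous (fun u => dsR κ u t * p₃ u t) :=
    (smooth_step hk).continuous.mul hr.continuous
  rw [intervalIntegral.integral_eq_sub_of_hasDerivAt (fun u _ => hd u)
    (hc.intervalIntegrable _ _)]
  ring
end
end

section
/- Let Γ : ℝ × J → ℝ³ be a smooth map such that each Γ(·,t) is a pseudo-arc parametrized null curve with curvature κ(s,t) and Frenet frame (t,n,b)(s,t), and write ∂Γ/∂t = p₁ t + p₂ n + p₃ b. Define q := −2(p₁ − ∂²p₃/∂s² − 2κ p₃). Then ∂q/∂s = ∂³p₃/∂s³ + 4κ ∂p₃/∂s + 2(∂κ/∂s) p₃ and the curvature evolves by ∂κ/∂t = −(1/4)(∂³q/∂s³ + 4κ ∂q/∂s + 2(∂κ/∂s) q). (This is the evolution equation κ_t = −(1/4)𝒟D⁻¹𝒟p₃ with 𝒟 = D³ + 4κD + 2κ_s.) -/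
noncomputable section

/-- Partial derivative in the second (time) variable, scalar-valued. -/
def dtR (f : ℝ → ℝ → ℝ) : ℝ → ℝ → ℝ := fun s t => deriv (fun x => f s x) t

def gs {E : Type} [NormedAddCommGroup E] [NormedSpace ℝ E] (f : ℝ → ℝ → E) : ℝ → ℝ → E :=
  fun s t => deriv (fun x => f x t) s

def gt {E : Type} [NormedAddCommGroup E] [NormedSpace ℝ E] (f : ℝ → ℝ → E) : ℝ → ℝ → E :=
  fun s t => deriv (fun x => f s x) t

def SmJ {E : Type} [NormedAddCommGroup E] [NormedSpace ℝ E] (J : Set ℝ) (f : ℝ → ℝ → E) : Prop :=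
  ContDiffOn ℝ (⊤ : ℕ∞) (fun p : ℝ × ℝ => f p.1 p.2) (Set.univ ×ˢ J)

section gen
variable {E : Type} [NormedAddCommGroup E] [NormedSpace ℝ E] {J : Set ℝ} {f g : ℝ → ℝ → E}

theorem SmJ.at (hJ : IsOpen J) (hf : SmJ J f) {s t : ℝ} (ht : t ∈ J) :
    ContDiffAt ℝ (⊤ : ℕ∞) (fun p : ℝ × ℝ => f p.1 p.2) (s, t) :=
  ContDiffOn.contDiffAt hf ((isOpen_univ.prod hJ).mem_nhds ⟨trivial, ht⟩)

theorem hs_aux (F : ℝ × ℝ → E) {s t : ℝ} (h : DifferentiableAt ℝ F (s, t)) :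
    HasDerivAt (fun x => F (x, t)) (fderiv ℝ F (s, t) (1, 0)) s := by
  have h1 : HasDerivAt (fun x : ℝ => (x, t)) ((1 : ℝ), (0 : ℝ)) s :=
    (hasDerivAt_id s).prodMk (hasDerivAt_const s t)
  exact h.hasFDerivAt.comp_hasDerivAt s h1

theorem ht_aux (F : ℝ × ℝ → E) {s t : ℝ} (h : DifferentiableAt ℝ F (s, t)) :
    HasDerivAt (fun x => F (s, x)) (fderiv ℝ F (s, t) (0, 1)) t := by
  have h1 : HasDerivAt (fun x : ℝ => (s, x)) ((0 : ℝ), (1 : ℝ)) t :=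
    (hasDerivAt_const t s).prodMk (hasDerivAt_id t)
  exact h.hasFDerivAt.comp_hasDerivAt t h1

theorem SmJ.diff (hJ : IsOpen J) (hf : SmJ J f) {s t : ℝ} (ht : t ∈ J) :
    DifferentiableAt ℝ (fun p : ℝ × ℝ => f p.1 p.2) (s, t) :=
  (hf.at hJ ht).differentiableAt (by simp)

theorem SmJ.hs (hJ : IsOpen J) (hf : SmJ J f) {t : ℝ} (ht : t ∈ J) (s : ℝ) :
    HasDerivAt (fun x => f x t) (gs f s t) s :=
  (hs_aux _ (hf.diff hJ ht)).differentiableAt.hasDerivAt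

theorem SmJ.ht (hJ : IsOpen J) (hf : SmJ J f) {t : ℝ} (ht : t ∈ J) (s : ℝ) :
    HasDerivAt (fun x => f s x) (gt f s t) t :=
  (ht_aux _ (hf.diff hJ ht)).differentiableAt.hasDerivAt

theorem SmJ.gs_eq (hJ : IsOpen J) (hf : SmJ J f) {t : ℝ} (ht : t ∈ J) (s : ℝ) :
    gs f s t = fderiv ℝ (fun p : ℝ × ℝ => f p.1 p.2) (s, t) (1, 0) :=
  (hs_aux _ (hf.diff hJ ht)).deriv

theorem SmJ.gt_eq (hJ : IsOpen J) (hf : SmJ J f) {t : ℝ} (ht : t ∈ J) (s : ℝ) :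
    gt f s t = fderiv ℝ (fun p : ℝ × ℝ => f p.1 p.2) (s, t) (0, 1) :=
  (ht_aux _ (hf.diff hJ ht)).deriv

theorem SmJ.fd (hJ : IsOpen J) (hf : SmJ J f) :
    ContDiffOn ℝ (⊤ : ℕ∞) (fderiv ℝ (fun p : ℝ × ℝ => f p.1 p.2)) (Set.univ ×ˢ J) :=
  ContDiffOn.fderiv_of_isOpen hf (isOpen_univ.prod hJ) (by simp)

theorem SmJ.gs (hJ : IsOpen J) (hf : SmJ J f) : SmJ J (gs f) := by
  have h := (hf.fd hJ).clm_apply (contDiffOn_const (c := ((1 : ℝ), (0 : ℝ))))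
  refine ContDiffOn.congr h ?_
  rintro ⟨s, t⟩ ⟨-, ht⟩
  exact hf.gs_eq hJ ht s

theorem SmJ.gt (hJ : IsOpen J) (hf : SmJ J f) : SmJ J (gt f) := by
  have h := (hf.fd hJ).clm_apply (contDiffOn_const (c := ((0 : ℝ), (1 : ℝ))))
  refine ContDiffOn.congr h ?_
  rintro ⟨s, t⟩ ⟨-, ht⟩
  exact hf.gt_eq hJ ht s

theorem gs_congr {t : ℝ} (h : ∀ s, f s t = g s t) (s : ℝ) : gs f s t = gs g s t := by
  have : (fun x => f x t) = fun x => g x t := funext h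
  simp only [_root_.gs, this]

theorem gt_congr (hJ : IsOpen J) {s : ℝ} (h : ∀ t ∈ J, f s t = g s t) {t : ℝ} (ht : t ∈ J) :
    gt f s t = gt g s t := by
  apply Filter.EventuallyEq.deriv_eq
  filter_upwards [hJ.mem_nhds ht] with x hx using h x hx

theorem SmJ.comm (hJ : IsOpen J) (hf : SmJ J f) {t : ℝ} (ht : t ∈ J) (s : ℝ) :
    _root_.gt (_root_.gs f) s t = _root_.gs (_root_.gt f) s t := by
  have hd : DifferentiableAt ℝ (fderiv ℝ (fun p : ℝ × ℝ => f p.1 p.2)) (s, t) :=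
    ((hf.fd hJ).contDiffAt ((isOpen_univ.prod hJ).mem_nhds ⟨trivial, ht⟩)).differentiableAt (by simp)
  have h1 := (hs_aux _ hd).clm_apply (hasDerivAt_const s ((0 : ℝ), (1 : ℝ)))
  have h2 := (ht_aux _ hd).clm_apply (hasDerivAt_const t ((1 : ℝ), (0 : ℝ)))
  rw [gs_congr (g := fun s t => fderiv ℝ (fun p : ℝ × ℝ => f p.1 p.2) (s, t) (0, 1))
      (fun s => hf.gt_eq hJ ht s) s,
    gt_congr (g := fun s t => fderiv ℝ (fun p : ℝ × ℝ => f p.1 p.2) (s, t) (1, 0)) hJ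
      (fun t ht => hf.gs_eq hJ ht s) ht]
  have hsym : IsSymmSndFDerivAt ℝ (fun p : ℝ × ℝ => f p.1 p.2) (s, t) :=
    (hf.at hJ ht).isSymmSndFDerivAt (by simp; exact WithTop.coe_le_coe.2 (le_top : (2 : ℕ∞) ≤ ⊤))
  have e1 := h1.deriv
  have e2 := h2.deriv
  simp only [map_zero, add_zero] at e1 e2
  refine e2.trans (Eq.trans ?_ e1.symm)
  exact hsym.eq _ _

end gen

theorem mink_hd {u v : ℝ → Fin 3 → ℝ} {u' v' : Fin 3 → ℝ} {x : ℝ} (hu : HasDerivAt u u' x)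
    (hv : HasDerivAt v v' x) :
    HasDerivAt (fun x => mink (u x) (v x)) (mink u' (v x) + mink (u x) v') x := by
  have a := hasDerivAt_pi.1 hu
  have b := hasDerivAt_pi.1 hv
  have := ((((a 0).mul (b 2)).add ((a 2).mul (b 0))).neg).add ((a 1).mul (b 1))
  refine this.congr_deriv ?_
  simp only [mink]; ring

theorem mink_sm {J : Set ℝ} {u v : ℝ → ℝ → Fin 3 → ℝ} (hu : SmJ J u) (hv : SmJ J v) :
    SmJ J (fun s t => mink (u s t) (v s t)) := by
  have a := contDiffOn_pi.1 hu
  have b := contDiffOn_pi.1 hv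
  exact ((((a 0).mul (b 2)).add ((a 2).mul (b 0))).neg).add ((a 1).mul (b 1))

theorem mink_add_right (u v w : Fin 3 → ℝ) : mink u (v + w) = mink u v + mink u w := by
  simp [mink]; ring
theorem mink_smul_right (c : ℝ) (u v : Fin 3 → ℝ) : mink u (c • v) = c * mink u v := by
  simp [mink]; ring
theorem mink_comm (u v : Fin 3 → ℝ) : mink u v = mink v u := by
  simp [mink]; ring

theorem mink_nondeg {T N M v : Fin 3 → ℝ} (h1 : mink T T = 0) (h2 : mink T N = 0)
    (h3 : mink N N = 1) (h4 : mink T M = -1) (h5 : mink N M = 0)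
    (v1 : mink T v = 0) (v2 : mink N v = 0) (v3 : mink M v = 0) : v = 0 := by
  set k := mink M M with hk
  -- dual-basis Gram argument through the determinant
  set A : Matrix (Fin 3) (Fin 3) ℝ := !![-T 2, T 1, -T 0; -N 2, N 1, -N 0; -M 2, M 1, -M 0] with hA
  set C : Matrix (Fin 3) (Fin 3) ℝ := !![T 0, N 0, M 0; T 1, N 1, M 1; T 2, N 2, M 2] with hC
  have hAC : A * C = !![0, 0, -1; 0, 1, 0; -1, 0, k] := by
    ext i j
    simp only [mink] at *
    fin_cases i <;> fin_cases j <;> simp [hA, hC, Matrix.mul_apply, Fin.sum_univ_three] <;> linarith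
  have hdet : A.det * C.det = -1 := by
    rw [← Matrix.det_mul, hAC]; simp [Matrix.det_fin_three]
  have hA0 : A.det ≠ 0 := by
    intro h; rw [h] at hdet; norm_num at hdet
  apply Matrix.eq_zero_of_mulVec_eq_zero hA0
  simp only [mink] at *
  ext i
  fin_cases i <;> simp [hA, Matrix.mulVec, dotProduct, Fin.sum_univ_three] <;> linarith

/-- for a motion `∂Γ/∂t = p₁ t + p₂ n + p₃ b` of null curves, with
`q := -2(p₁ - ∂²p₃/∂s² - 2κp₃)`, one has `∂q/∂s = 𝒟p₃` and
`∂κ/∂t = -(1/4)𝒟q`, where `𝒟 = D³ + 4κD + 2κ_s`. -/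
theorem stmt7 (J : Set ℝ) (hJopen : IsOpen J) (hJconn : J.OrdConnected)
    (Γ : ℝ → ℝ → Fin 3 → ℝ)
    (hΓ : ContDiffOn ℝ (⊤ : ℕ∞) (fun p : ℝ × ℝ => Γ p.1 p.2) (Set.univ ×ˢ J))
    (hnull : ∀ s : ℝ, ∀ t ∈ J, mink (dsV Γ s t) (dsV Γ s t) = 0)
    (hfut : ∀ s : ℝ, ∀ t ∈ J, mink (dsV Γ s t) ![1, 0, 1] < 0)
    (hpa : ∀ s : ℝ, ∀ t ∈ J, mink (dsV (dsV Γ) s t) (dsV (dsV Γ) s t) = 1)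
    (κ : ℝ → ℝ → ℝ)
    (hκ : ∀ s t, κ s t = (1/4) * mink (dsV (dsV (dsV Γ)) s t) (dsV (dsV (dsV Γ)) s t))
    (T N B : ℝ → ℝ → Fin 3 → ℝ)
    (hT : ∀ s t, T s t = dsV Γ s t)
    (hN : ∀ s t, N s t = dsV (dsV Γ) s t)
    (hB : ∀ s t, B s t = dsV (dsV (dsV Γ)) s t + (2 * κ s t) • dsV Γ s t)
    (p₁ p₂ p₃ : ℝ → ℝ → ℝ)
    (hp₁ : ContDiffOn ℝ (⊤ : ℕ∞) (fun p : ℝ × ℝ => p₁ p.1 p.2) (Set.univ ×ˢ J))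
    (hp₂ : ContDiffOn ℝ (⊤ : ℕ∞) (fun p : ℝ × ℝ => p₂ p.1 p.2) (Set.univ ×ˢ J))
    (hp₃ : ContDiffOn ℝ (⊤ : ℕ∞) (fun p : ℝ × ℝ => p₃ p.1 p.2) (Set.univ ×ˢ J))
    (hmotion : ∀ s : ℝ, ∀ t ∈ J,
      dtV Γ s t = p₁ s t • T s t + p₂ s t • N s t + p₃ s t • B s t)
    (q : ℝ → ℝ → ℝ)
    (hq : ∀ s t, q s t = -2 * (p₁ s t - dsR (dsR p₃) s t - 2 * κ s t * p₃ s t)) :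
    (∀ s : ℝ, ∀ t ∈ J,
      dsR q s t =
        dsR (dsR (dsR p₃)) s t + 4 * κ s t * dsR p₃ s t + 2 * dsR κ s t * p₃ s t) ∧
    (∀ s : ℝ, ∀ t ∈ J,
      dtR κ s t =
        -(1/4) * (dsR (dsR (dsR q)) s t + 4 * κ s t * dsR q s t + 2 * dsR κ s t * q s t)) := by
  have HΓ : SmJ J Γ := hΓ
  have P1 : SmJ J p₁ := hp₁
  have P2 : SmJ J p₂ := hp₂
  have P3 : SmJ J p₃ := hp₃
  obtain rfl : T = gs Γ := by funext s t; exact hT s t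
  obtain rfl : N = gs (gs Γ) := by funext s t; exact hN s t
  have eV : dsV = gs := rfl
  have eR : dsR = gs := rfl
  have eVt : dtV = gt := rfl
  have eRt : dtR = gt := rfl
  simp only [eV, eR, eVt, eRt] at *
  clear hT hN
  have ST := HΓ.gs hJopen
  set T := gs Γ with hTdef
  have SN := ST.gs hJopen
  set N := gs T with hNdef
  have SM := SN.gs hJopen
  set M := gs N with hMdef
  have Sκ : SmJ J κ := by
    have h : SmJ J (fun s t => (1/4 : ℝ) * mink (M s t) (M s t)) :=
      contDiffOn_const.mul (mink_sm SM SM)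
    have e : κ = (fun s t => (1/4 : ℝ) * mink (M s t) (M s t)) := by
      funext s t; exact hκ s t
    rw [e]; exact h
  have SB : SmJ J B := by
    have e : B = fun s t => M s t + (2 * κ s t) • T s t := by
      funext s t; exact hB s t
    rw [e]
    exact ContDiffOn.add SM ((contDiffOn_const.mul Sκ).smul ST)
  -- Gram relations
  have dconst : ∀ {u v : ℝ → ℝ → Fin 3 → ℝ} {c : ℝ}, SmJ J u → SmJ J v →
      (∀ s, ∀ t ∈ J, mink (u s t) (v s t) = c) → ∀ s, ∀ t ∈ J,
      mink (gs u s t) (v s t) + mink (u s t) (gs v s t) = 0 := by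
    intro u v c hu hv h s t ht
    have h1 := mink_hd (hu.hs hJopen ht s) (hv.hs hJopen ht s)
    have e : (fun x => mink (u x t) (v x t)) = fun _ => c := funext fun x => h x t ht
    rw [e] at h1
    exact h1.unique (hasDerivAt_const s c)
  have tconst : ∀ {u v : ℝ → ℝ → Fin 3 → ℝ} {c : ℝ}, SmJ J u → SmJ J v →
      (∀ s, ∀ t ∈ J, mink (u s t) (v s t) = c) → ∀ s, ∀ t ∈ J,
      mink (gt u s t) (v s t) + mink (u s t) (gt v s t) = 0 := by
    intro u v c hu hv h s t ht
    have h1 := mink_hd (hu.ht hJopen ht s) (hv.ht hJopen ht s)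
    have h2 : HasDerivAt (fun x => mink (u s x) (v s x)) 0 t := by
      refine (hasDerivAt_const t c).congr_of_eventuallyEq ?_
      filter_upwards [hJopen.mem_nhds ht] with x hx using h s x hx
    exact h1.unique h2
  have gTN : ∀ s, ∀ t ∈ J, mink (T s t) (N s t) = 0 := by
    intro s t ht
    have := dconst ST ST hnull s t ht
    rw [← hNdef, mink_comm (N s t)] at this; linarith
  have gNM : ∀ s, ∀ t ∈ J, mink (N s t) (M s t) = 0 := by
    intro s t ht
    have := dconst SN SN hpa s t ht
    rw [← hMdef, mink_comm (M s t)] at this; linarith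
  have gTM : ∀ s, ∀ t ∈ J, mink (T s t) (M s t) = -1 := by
    intro s t ht
    have := dconst ST SN gTN s t ht
    rw [← hMdef, ← hNdef, hpa s t ht] at this; linarith
  have gMM : ∀ s t, mink (M s t) (M s t) = 4 * κ s t := by
    intro s t; rw [hκ]; ring
  have dMM : ∀ s, ∀ t ∈ J, mink (M s t) (gs M s t) = 2 * gs κ s t := by
    intro s t ht
    have h1 := mink_hd (SM.hs hJopen ht s) (SM.hs hJopen ht s)
    have e : (fun x => mink (M x t) (M x t)) = fun x => 4 * κ x t := funext fun x => gMM x t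
    rw [e] at h1
    have := h1.unique ((Sκ.hs hJopen ht s).const_mul 4)
    rw [mink_comm (gs M s t)] at this; linarith
  have tMM : ∀ s, ∀ t ∈ J, mink (M s t) (gt M s t) = 2 * gt κ s t := by
    intro s t ht
    have h1 := mink_hd (SM.ht hJopen ht s) (SM.ht hJopen ht s)
    have e : (fun x => mink (M s x) (M s x)) = fun x => 4 * κ s x := funext fun x => gMM s x
    rw [e] at h1
    have := h1.unique ((Sκ.ht hJopen ht s).const_mul 4)
    rw [mink_comm (gt M s t)] at this; linarith
  have dTM : ∀ s, ∀ t ∈ J, mink (T s t) (gs M s t) = 0 := by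
    intro s t ht
    have := dconst ST SM gTM s t ht
    rw [← hNdef, gNM s t ht] at this; linarith
  have dNM : ∀ s, ∀ t ∈ J, mink (N s t) (gs M s t) = -4 * κ s t := by
    intro s t ht
    have := dconst SN SM gNM s t ht
    rw [← hMdef, gMM s t] at this; linarith
  have hM' : ∀ s, ∀ t ∈ J, gs M s t = (-2 * gs κ s t) • T s t + (-4 * κ s t) • N s t := by
    intro s t ht
    have key : gs M s t + (2 * gs κ s t) • T s t + (4 * κ s t) • N s t = 0 := by
      apply mink_nondeg (hnull s t ht) (gTN s t ht) (hpa s t ht) (gTM s t ht) (gNM s t ht)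
      · simp only [mink_add_right, mink_smul_right, hnull s t ht, gTN s t ht, dTM s t ht]; ring
      · simp only [mink_add_right, mink_smul_right, hpa s t ht, mink_comm (N s t) (T s t),
          gTN s t ht, dNM s t ht]; ring
      · simp only [mink_add_right, mink_smul_right, mink_comm (M s t) (T s t),
          mink_comm (M s t) (N s t), gTM s t ht, gNM s t ht, dMM s t ht]; ring
    have e : gs M s t = (gs M s t + (2 * gs κ s t) • T s t + (4 * κ s t) • N s t)
        + ((-2 * gs κ s t) • T s t + (-4 * κ s t) • N s t) := by module
    rw [key, zero_add] at e
    exact e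
  have hB' : ∀ s, ∀ t ∈ J, HasDerivAt (fun x => B x t) ((-2 * κ s t) • N s t) s := by
    intro s t ht
    have e : (fun x => B x t) = fun x => M x t + (2 * κ x t) • T x t := funext fun x => hB x t
    rw [e]
    refine ((SM.hs hJopen ht s).add
      (((Sκ.hs hJopen ht s).const_mul 2).smul (ST.hs hJopen ht s))).congr_deriv ?_
    rw [hM' s t ht, ← hNdef]
    module
  have frame : ∀ {a b c : ℝ → ℝ → ℝ}, SmJ J a → SmJ J b → SmJ J c →
      ∀ {f : ℝ → ℝ → Fin 3 → ℝ},
      (∀ s, ∀ t ∈ J, f s t = a s t • T s t + b s t • N s t + c s t • B s t) →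
      ∀ s, ∀ t ∈ J, gs f s t = (gs a s t - 2 * κ s t * b s t) • T s t
        + (a s t + gs b s t - 2 * κ s t * c s t) • N s t + (b s t + gs c s t) • B s t := by
    intro a b c ha hb hc f hf s t ht
    rw [gs_congr (g := fun s t => a s t • T s t + b s t • N s t + c s t • B s t)
      (fun s => hf s t ht) s]
    have := ((((ha.hs hJopen ht s).smul (ST.hs hJopen ht s)).add
      ((hb.hs hJopen ht s).smul (SN.hs hJopen ht s))).add
      ((hc.hs hJopen ht s).smul (hB' s t ht))).deriv
    refine Eq.trans this ?_
    rw [← hNdef, ← hMdef]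
    have e : M s t = B s t - (2 * κ s t) • T s t := by rw [hB s t]; module
    rw [e]
    module
  have gTB : ∀ s, ∀ t ∈ J, mink (T s t) (B s t) = -1 := by
    intro s t ht
    rw [hB s t, mink_add_right, mink_smul_right, hnull s t ht, gTM s t ht]; ring
  have gNB : ∀ s, ∀ t ∈ J, mink (N s t) (B s t) = 0 := by
    intro s t ht
    rw [hB s t, mink_add_right, mink_smul_right, mink_comm (N s t) (T s t), gTN s t ht,
      gNM s t ht]; ring
  have gMB : ∀ s, ∀ t ∈ J, mink (M s t) (B s t) = 2 * κ s t := by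
    intro s t ht
    rw [hB s t, mink_add_right, mink_smul_right, mink_comm (M s t) (T s t), gTM s t ht,
      gMM s t]; ring
  -- T_t
  obtain ⟨a, ha⟩ : ∃ a : ℝ → ℝ → ℝ, a = fun s t => gs p₁ s t - 2 * κ s t * p₂ s t := ⟨_, rfl⟩
  obtain ⟨b, hb⟩ : ∃ b : ℝ → ℝ → ℝ, b = fun s t => p₁ s t + gs p₂ s t - 2 * κ s t * p₃ s t :=
    ⟨_, rfl⟩
  have Sa : SmJ J a := by
    rw [ha]
    exact ContDiffOn.sub (P1.gs hJopen) ((contDiffOn_const.mul Sκ).mul P2)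
  have Sb : SmJ J b := by
    rw [hb]
    exact ContDiffOn.sub (ContDiffOn.add P1 (P2.gs hJopen)) ((contDiffOn_const.mul Sκ).mul P3)
  have S0 : SmJ J (fun _ _ => (0 : ℝ)) := contDiffOn_const
  have g0 : ∀ s t, gs (fun _ _ => (0 : ℝ)) s t = 0 := by intro s t; simp [gs]
  have hTt0 : ∀ s, ∀ t ∈ J, gt T s t = a s t • T s t + b s t • N s t
      + (p₂ s t + gs p₃ s t) • B s t := by
    intro s t ht
    rw [hTdef, HΓ.comm hJopen ht s, frame P1 P2 P3 hmotion s t ht, ha, hb]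
  have hp2 : ∀ s, ∀ t ∈ J, p₂ s t = - gs p₃ s t := by
    intro s t ht
    have h := tconst ST ST hnull s t ht
    rw [mink_comm (gt T s t), hTt0 s t ht] at h
    simp only [mink_add_right, mink_smul_right, hnull s t ht, gTN s t ht, gTB s t ht] at h
    linarith
  have hTt : ∀ s, ∀ t ∈ J, gt T s t = a s t • T s t + b s t • N s t
      + (0 : ℝ) • B s t := by
    intro s t ht
    rw [hTt0 s t ht, hp2 s t ht]; module
  have hNt0 : ∀ s, ∀ t ∈ J, gt N s t = (gs a s t - 2 * κ s t * b s t) • T s t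
      + (a s t + gs b s t) • N s t + b s t • B s t := by
    intro s t ht
    rw [hNdef, ST.comm hJopen ht s, frame Sa Sb S0 hTt s t ht, g0]
    module
  have hab : ∀ s, ∀ t ∈ J, a s t = - gs b s t := by
    intro s t ht
    have h := tconst SN SN hpa s t ht
    rw [mink_comm (gt N s t), hNt0 s t ht] at h
    simp only [mink_add_right, mink_smul_right, hpa s t ht, mink_comm (N s t) (T s t),
      gTN s t ht, gNB s t ht] at h
    linarith
  obtain ⟨d, hd⟩ : ∃ d : ℝ → ℝ → ℝ, d = fun s t => gs a s t - 2 * κ s t * b s t := ⟨_, rfl⟩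
  have Sd : SmJ J d := by
    rw [hd]
    exact ContDiffOn.sub (Sa.gs hJopen) ((contDiffOn_const.mul Sκ).mul Sb)
  have hNt : ∀ s, ∀ t ∈ J, gt N s t = d s t • T s t + (0 : ℝ) • N s t + b s t • B s t := by
    intro s t ht
    rw [hNt0 s t ht, hab s t ht, hd]; module
  have hMt : ∀ s, ∀ t ∈ J, gt M s t = gs d s t • T s t + (d s t - 2 * κ s t * b s t) • N s t
      + gs b s t • B s t := by
    intro s t ht
    rw [hMdef, SN.comm hJopen ht s, frame Sd S0 Sb hNt s t ht, g0]
    module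
  have hqb : ∀ s, ∀ t ∈ J, q s t = -2 * b s t := by
    intro s t ht
    have h2 : gs p₂ s t = - gs (gs p₃) s t := by
      rw [gs_congr (g := fun s t => - gs p₃ s t) (fun s => hp2 s t ht) s]
      exact ((P3.gs hJopen).hs hJopen ht s).neg.deriv
    rw [hq, hb]; simp only [h2]; ring
  have dcm : ∀ {f g : ℝ → ℝ → ℝ} {c : ℝ}, SmJ J g → (∀ s, ∀ t ∈ J, f s t = c * g s t) →
      ∀ s, ∀ t ∈ J, gs f s t = c * gs g s t := by
    intro f g c hg h s t ht
    rw [gs_congr (g := fun s t => c * g s t) (fun s => h s t ht) s]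
    exact ((hg.hs hJopen ht s).const_mul c).deriv
  have Sb1 := Sb.gs hJopen
  have Sb2 := Sb1.gs hJopen
  have q1 := dcm Sb hqb
  have q2 := dcm Sb1 q1
  have q3 := dcm Sb2 q2
  have a1 : ∀ s, ∀ t ∈ J, gs a s t = -1 * gs (gs b) s t :=
    dcm Sb1 (fun s t ht => by rw [hab s t ht]; ring)
  have a2 := dcm Sb2 a1
  constructor
  · intro s t ht
    have P32 := (P3.gs hJopen).gs hJopen
    have h1 : gs q s t = -2 * (gs p₁ s t - gs (gs (gs p₃)) s t
        - (2 * gs κ s t * p₃ s t + 2 * κ s t * gs p₃ s t)) := by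
      rw [gs_congr (g := fun s t => -2 * (p₁ s t - gs (gs p₃) s t - 2 * κ s t * p₃ s t))
        (fun s => hq s t) s]
      exact ((((P1.hs hJopen ht s).sub (P32.hs hJopen ht s)).sub
        (((Sκ.hs hJopen ht s).const_mul 2).mul (P3.hs hJopen ht s))).const_mul (-2)).deriv
    have h2 := hab s t ht
    have h3 := q1 s t ht
    rw [ha] at h2
    simp only [hp2 s t ht] at h2
    linarith
  · intro s t ht
    have h := tMM s t ht
    have hd1 : gs d s t = gs (gs a) s t - (2 * gs κ s t * b s t + 2 * κ s t * gs b s t) := by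
      rw [hd]
      exact ((((Sa.gs hJopen).hs hJopen ht s)).sub
        (((Sκ.hs hJopen ht s).const_mul 2).mul (Sb.hs hJopen ht s))).deriv
    rw [hMt s t ht] at h
    simp only [mink_add_right, mink_smul_right, mink_comm (M s t) (T s t),
      mink_comm (M s t) (N s t), gTM s t ht, gNM s t ht, gMB s t ht] at h
    rw [hd1, a2 s t ht] at h
    rw [q3 s t ht, q1 s t ht, hqb s t ht]
    linarith
end
end

section
/- Let κ, p₃, q : ℝ² → ℝ be smooth functions of (s,t) satisfying ∂q/∂s = ∂³p₃/∂s³ + 4κ ∂p₃/∂s + 2(∂κ/∂s)p₃ and ∂κ/∂t = −(1/4)(∂³q/∂s³ + 4κ ∂q/∂s + 2(∂κ/∂s)q). Set p₁ := ∂²p₃/∂s² + 2κp₃ − q/2 and p₂ := −∂p₃/∂s. Then there exists a smooth map Γ : ℝ² → ℝ³ such that each Γ(·,t) is a pseudo-arc parametrized null curve with curvature κ(·,t), and ∂Γ/∂t = p₁ t + p₂ n + p₃ b, where (t,n,b)(s,t) is the Frenet frame of Γ(·,t). -/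
noncomputable section

abbrev VV := ℝ × ℝ

open Set Filter Topology in
lemma lin_ode (M : ℝ → VV →L[ℝ] VV) (hM : Continuous M) (x0 : VV) :
    ∃ y : ℝ → VV, y 0 = x0 ∧ ∀ t ∈ Icc (0:ℝ) 1, HasDerivWithinAt y (M t (y t)) (Icc 0 1) t := by
  obtain ⟨K0, hK0⟩ := (isCompact_Icc (a := (0:ℝ)) (b := 1)).exists_bound_of_continuousOn hM.continuousOn
  obtain ⟨K, hKpos, hK⟩ : ∃ K : NNReal, 0 < K ∧ ∀ t ∈ Icc (0:ℝ) 1, ‖M t‖ ≤ K := by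
    refine ⟨⟨|K0| + 1, by positivity⟩, ?_, fun t ht => (hK0 t ht).trans ?_⟩
    · exact_mod_cast (by positivity : (0:ℝ) < |K0| + 1)
    · change K0 ≤ |K0| + 1; linarith [le_abs_self K0]
  let R : NNReal := ⟨‖x0‖ * Real.exp K, by positivity⟩
  have hR : (R : ℝ) = ‖x0‖ * Real.exp K := rfl
  let c : ℝ → ℝ := fun x => max (-(R:ℝ)) (min R x)
  have hcR : ∀ x, |c x| ≤ R := fun x => by
    have := R.2
    rw [abs_le]; exact ⟨le_max_left _ _, max_le (by linarith [R.coe_nonneg]) (min_le_left _ _)⟩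
  have hcx : ∀ x, |c x| ≤ |x| := fun x => by
    have := R.coe_nonneg
    rw [abs_le]
    refine ⟨le_max_of_le_right (le_min (by linarith [abs_nonneg x]) (neg_abs_le x)), max_le (by linarith [abs_nonneg x]) ((min_le_right _ _).trans (le_abs_self x))⟩
  have hcid : ∀ x : ℝ, |x| ≤ R → c x = x := fun x hx => by
    rw [abs_le] at hx
    simp only [c]; rw [min_eq_right hx.2, max_eq_right hx.1]
  have hcl : LipschitzWith 1 c := (LipschitzWith.id.const_min _).const_max _
  let ρ : VV → VV := fun x => (c x.1, c x.2)
  have hρl : LipschitzWith 1 ρ := by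
    have := (hcl.comp LipschitzWith.prod_fst).prodMk (hcl.comp (LipschitzWith.prod_snd (α := ℝ) (β := ℝ)))
    simpa using this
  have hρR : ∀ x, ‖ρ x‖ ≤ R := fun x => by
    rw [Prod.norm_def]; exact max_le (hcR _) (hcR _)
  have hρx : ∀ x, ‖ρ x‖ ≤ ‖x‖ := fun x => by
    rw [Prod.norm_def, Prod.norm_def]; exact max_le_max (hcx _) (hcx _)
  have hρid : ∀ x, ‖x‖ ≤ R → ρ x = x := fun x hx => by
    rw [Prod.norm_def] at hx
    exact Prod.ext (hcid _ ((le_max_left _ _).trans hx)) (hcid _ ((le_max_right _ _).trans hx))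
  have hPL : IsPicardLindelof (fun t x => M t (ρ x)) (tmin := 0) (tmax := 1) ⟨0, by simp⟩ x0 (K * R) 0 (K * R) K := by
    refine ⟨fun t ht => ?_, fun x _ => ?_, fun t ht x _ => ?_, ?_⟩
    · have h1 : LipschitzWith K (M t) := (M t).lipschitz.weaken (by exact_mod_cast hK t ht)
      have := h1.comp hρl
      rw [mul_one] at this
      exact this.lipschitzOnWith
    · exact (hM.clm_apply continuous_const).continuousOn
    · calc ‖M t (ρ x)‖ ≤ ‖M t‖ * ‖ρ x‖ := (M t).le_opNorm _
        _ ≤ K * R := mul_le_mul (hK t ht) (hρR x) (norm_nonneg _) K.2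
        _ = _ := by push_cast; rfl
    · simp
  obtain ⟨y, hy0, hy⟩ := hPL.exists_eq_forall_mem_Icc_hasDerivWithinAt₀
  refine ⟨y, hy0, fun t ht => ?_⟩
  have hb : ∀ t ∈ Icc (0:ℝ) 1, ‖y t‖ ≤ gronwallBound ‖x0‖ K 0 (t - 0) := by
    refine norm_le_gronwallBound_of_norm_deriv_right_le (f' := fun t => M t (ρ (y t)))
      (fun t ht => (hy t ht).continuousWithinAt) (fun t ht => ?_) ?_ fun t ht => ?_
    · exact (hy t (Ico_subset_Icc_self ht)).mono_of_mem_nhdsWithin (Icc_mem_nhdsGE_of_mem ht)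
    · exact (congrArg norm hy0).le
    · rw [add_zero]
      exact ((M t).le_opNorm _).trans (mul_le_mul (hK t (Ico_subset_Icc_self ht)) (hρx _) (norm_nonneg _) K.2)
  have h := hy t ht
  rwa [hρid] at h
  refine (hb t ht).trans ?_
  rw [gronwallBound_ε0, hR]
  gcongr
  have := K.coe_nonneg
  have := ht.2
  nlinarith [ht.1]

lemma ray_hasFDerivAt {V F : Type*} [NormedAddCommGroup V] [NormedSpace ℝ V] [NormedAddCommGroup F]
    [NormedSpace ℝ F] (ω : V → V →L[ℝ] F) (hωd : ∀ x, HasFDerivAt ω (fderiv ℝ ω x) x) (r : ℝ) (x : V) :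
    HasFDerivAt (fun x => ω (r • x) x) (ω (r • x) + r • (fderiv ℝ ω (r • x)).flip x) x := by
  have h1 : HasFDerivAt (fun x : V => r • x) (r • ContinuousLinearMap.id ℝ V) x :=
    (hasFDerivAt_id x).const_smul r
  have h2 := (hωd (r • x)).comp x h1
  have h3 := h2.clm_apply (hasFDerivAt_id x)
  refine h3.congr_fderiv ?_
  ext h; simp

lemma ray_hasDerivAt {V F : Type*} [NormedAddCommGroup V] [NormedSpace ℝ V] [NormedAddCommGroup F]
    [NormedSpace ℝ F] (ω : V → F) (hωd : ∀ x, HasFDerivAt ω (fderiv ℝ ω x) x) (r : ℝ) (p : V) :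
    HasDerivAt (fun r : ℝ => ω (r • p)) (fderiv ℝ ω (r • p) p) r := by
  have : HasDerivAt (fun r : ℝ => r • p) p r := by
    simpa using (hasDerivAt_id r).smul_const p
  exact (hωd (r • p)).comp_hasDerivAt r this

open Topology in
lemma ev_close {V F : Type*} [NormedAddCommGroup V] [NormedAddCommGroup F]
    (G : ℝ → V → F) (hGc : Continuous (fun z : V × ℝ => G z.2 z.1)) (p : V) (r : ℝ)
    (ε : ℝ) (hε : 0 < ε) : ∀ᶠ z : V × ℝ in 𝓝 (p, r), ‖G z.2 z.1 - G z.2 p‖ ≤ ε := by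
  have c2 : Continuous (fun z : V × ℝ => ‖G z.2 z.1 - G z.2 p‖) := by
    have : Continuous (fun z : V × ℝ => G z.2 p) := hGc.comp (continuous_const.prodMk continuous_snd)
    exact (hGc.sub this).norm
  filter_upwards [c2.continuousAt.eventually_lt (continuousAt_const (y := ε)) (x₀ := (p, r)) (by simpa using hε)] with z hz using hz.le

open Set Filter Topology in
lemma frob {V E : Type*} [NormedAddCommGroup V] [NormedSpace ℝ V] [NormedAddCommGroup E]
    [NormedSpace ℝ E]
    (lin : ∀ M : ℝ → E →L[ℝ] E, Continuous M → ∀ x0 : E, ∃ y : ℝ → E, y 0 = x0 ∧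
      ∀ t ∈ Icc (0:ℝ) 1, HasDerivWithinAt y (M t (y t)) (Icc 0 1) t)
    (ω : V → V →L[ℝ] E →L[ℝ] E) (hω : ContDiff ℝ (⊤ : ℕ∞) ω)
    (flat : ∀ x a b e, fderiv ℝ ω x a b e + ω x b (ω x a e) = fderiv ℝ ω x b a e + ω x a (ω x b e))
    (x0 : E) :
    ∃ X : V → E, X 0 = x0 ∧ ∀ p, HasFDerivAt X ((ω p).flip (X p)) p := by
  have hωc : Continuous ω := hω.continuous
  have hωd : ∀ x, HasFDerivAt ω (fderiv ℝ ω x) x := fun x =>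
    (hω.differentiable (by simp) x).hasFDerivAt
  have hω' : Continuous (fderiv ℝ ω) := hω.continuous_fderiv (by simp)
  have hex : ∀ p : V, ∃ y : ℝ → E, y 0 = x0 ∧
      ∀ t ∈ Icc (0:ℝ) 1, HasDerivWithinAt y (ω (t • p) p (y t)) (Icc 0 1) t := fun p =>
    lin (fun t => ω (t • p) p) (by fun_prop) x0
  choose U hU0 hU using hex
  have hUc : ∀ p, ContinuousOn (U p) (Icc 0 1) := fun p t ht => (hU p t ht).continuousWithinAt
  have hUr : ∀ p, ∀ t ∈ Ico (0:ℝ) 1, HasDerivWithinAt (U p) (ω (t • p) p (U p t)) (Ici t) t :=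
    fun p t ht => (hU p t (Ico_subset_Icc_self ht)).mono_of_mem_nhdsWithin (Icc_mem_nhdsGE_of_mem ht)
  refine ⟨fun p => U p 1, ?_, fun p => ?_⟩
  · have := constant_of_has_deriv_right_zero (hUc 0) (fun t ht => by simpa using hUr 0 t ht) 1 (by simp)
    simp only [this, hU0]
  -- the parameter-dependent coefficient
  let m : ℝ → V → E →L[ℝ] E := fun r x => ω (r • x) x
  let G : ℝ → V → V →L[ℝ] E →L[ℝ] E := fun r x => ω (r • x) + r • (fderiv ℝ ω (r • x)).flip x
  have hG : ∀ r x, HasFDerivAt (m r) (G r x) x :=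
    fun r x => ray_hasFDerivAt ω hωd r x
  have hmc : Continuous (fun z : V × ℝ => m z.2 z.1) := by
    simp only [m]; fun_prop
  have hGc : Continuous (fun z : V × ℝ => G z.2 z.1) := by
    have : Continuous (fun z : V × ℝ => (fderiv ℝ ω (z.2 • z.1)).flip) :=
      (ContinuousLinearMap.flipₗᵢ ℝ V V (E →L[ℝ] E)).continuous.comp (by fun_prop)
    simp only [G]; fun_prop
  have hIc : IsCompact (Icc (0:ℝ) 1) := isCompact_Icc
  obtain ⟨K1, hK1⟩ := hIc.exists_bound_of_continuousOn (f := fun r => m r p)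
    (by simp only [m]; fun_prop)
  obtain ⟨K2, hK2⟩ := hIc.exists_bound_of_continuousOn (f := fun r => ω (r • p))
    (by fun_prop)
  obtain ⟨K3, hK3⟩ := hIc.exists_bound_of_continuousOn (hUc p)
  have z01 : (0:ℝ) ∈ Icc (0:ℝ) 1 := by simp
  have K1n : 0 ≤ K1 := (norm_nonneg _).trans (hK1 0 z01)
  have K2n : 0 ≤ K2 := (norm_nonneg _).trans (hK2 0 z01)
  have K3n : 0 ≤ K3 := (norm_nonneg _).trans (hK3 0 z01)
  have key : ∀ ε > 0, ε ≤ 1 → ∀ᶠ h in 𝓝 (0 : V),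
      ‖U (p + h) 1 - U p 1 - ω p h (U p 1)‖ ≤ gronwallBound 0 (K1 + 1) (ε * ‖h‖ * (1 + K2) * K3) 1 := by
    intro ε hε hε1
    have e1 : ∀ᶠ x in 𝓝 p, ∀ r ∈ Icc (0:ℝ) 1, ‖m r x - m r p‖ ≤ ε ∧ ‖G r x - G r p‖ ≤ ε := by
      refine hIc.eventually_forall_of_forall_eventually fun r hr => ?_
      exact (ev_close m hmc p r ε hε).and (ev_close G hGc p r ε hε)
    obtain ⟨δ, hδ, hball⟩ := Metric.eventually_nhds_iff_ball.1 e1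
    filter_upwards [Metric.ball_mem_nhds (0:V) hδ] with h hh
    have hph : p + h ∈ Metric.ball p δ := by simpa [dist_eq_norm] using hh
    have hM2 : ∀ r ∈ Icc (0:ℝ) 1, ‖m r (p + h) - m r p - G r p h‖ ≤ ε * ‖h‖ := by
      intro r hr
      have := Convex.norm_image_sub_le_of_norm_hasFDerivWithin_le' (f := m r) (f' := G r) (φ := G r p)
        (s := Metric.ball p δ) (C := ε) (fun x _ => (hG r x).hasFDerivWithinAt)
        (fun x hx => (hball x hx r hr).2) (convex_ball p δ) (Metric.mem_ball_self hδ) hph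
      simpa using this
    let D : ℝ → E := fun r => U (p + h) r - U p r - r • ω (r • p) h (U p r)
    let D' : ℝ → E := fun r => m r (p + h) (D r) + (m r (p + h) - m r p - G r p h) (U p r)
      + r • (m r (p + h) - m r p) (ω (r • p) h (U p r))
    have hD : ∀ r ∈ Ico (0:ℝ) 1, HasDerivWithinAt D (D' r) (Ici r) r := by
      intro r hr
      have a1 := hUr (p + h) r hr
      have a2 := hUr p r hr
      have a3 : HasDerivWithinAt (fun r : ℝ => ω (r • p)) (fderiv ℝ ω (r • p) p) (Ici r) r:=
        (ray_hasDerivAt ω hωd r p).hasDerivWithinAt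
      have a4 := (a3.clm_apply (hasDerivWithinAt_const r (Ici r) h)).clm_apply a2
      have a5 := (a1.sub a2).sub ((hasDerivWithinAt_id r (Ici r)).smul a4)
      refine a5.congr_deriv ?_
      have fl := flat (r • p) p h (U p r)
      have fl' : fderiv ℝ ω (r • p) p h (U p r) = fderiv ℝ ω (r • p) h p (U p r) +
        ω (r • p) p (ω (r • p) h (U p r)) - ω (r • p) h (ω (r • p) p (U p r)) := by
        rw [← fl]; abel
      simp only [D', D, m, G, id]
      simp [fl']
      module
    have hDc : ContinuousOn D (Icc 0 1) := by
      have b1 := hUc (p + h)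
      have b2 := hUc p
      have b3 : ContinuousOn (fun r : ℝ => ω (r • p) h) (Icc 0 1) := by fun_prop
      exact (b1.sub b2).sub (continuousOn_id.smul (b3.clm_apply b2))
    have := norm_le_gronwallBound_of_norm_deriv_right_le (δ := 0) (K := K1 + 1)
      (ε := ε * ‖h‖ * (1 + K2) * K3) hDc hD (by simp [D, hU0]) ?_ 1 (by simp)
    · simpa [D] using this
    intro r hr'
    have hr := Ico_subset_Icc_self hr'
    have n1 : ‖m r (p + h)‖ ≤ K1 + 1 := by
      have := (hball _ hph r hr).1
      have h2 := hK1 r hr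
      have h3 := norm_add_le (m r (p + h) - m r p) (m r p)
      rw [sub_add_cancel] at h3
      linarith
    have n2 : ‖m r (p + h) (D r)‖ ≤ (K1 + 1) * ‖D r‖ :=
      ((m r (p + h)).le_opNorm _).trans (by gcongr)
    have n3 : ‖(m r (p + h) - m r p - G r p h) (U p r)‖ ≤ (ε * ‖h‖) * K3 :=
      (ContinuousLinearMap.le_opNorm _ _).trans
        (mul_le_mul (hM2 r hr) (hK3 r hr) (norm_nonneg _) (by positivity))
    have n4 : ‖ω (r • p) h (U p r)‖ ≤ (K2 * ‖h‖) * K3 :=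
      (ContinuousLinearMap.le_opNorm _ _).trans
        (mul_le_mul (((ω (r • p)).le_opNorm h).trans (by gcongr; exact hK2 r hr)) (hK3 r hr)
          (norm_nonneg _) (by positivity))
    have n5 : ‖(m r (p + h) - m r p) (ω (r • p) h (U p r))‖ ≤ ε * ((K2 * ‖h‖) * K3) :=
      (ContinuousLinearMap.le_opNorm _ _).trans
        (mul_le_mul (hball _ hph r hr).1 n4 (norm_nonneg _) hε.le)
    have n6 : ‖r • (m r (p + h) - m r p) (ω (r • p) h (U p r))‖ ≤ ε * ((K2 * ‖h‖) * K3) := by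
      rw [norm_smul, Real.norm_of_nonneg hr.1]
      exact (mul_le_of_le_one_left (norm_nonneg _) hr.2).trans n5
    calc ‖D' r‖ ≤ _ := norm_add₃_le
      _ ≤ (K1 + 1) * ‖D r‖ + (ε * ‖h‖) * K3 + ε * ((K2 * ‖h‖) * K3) := add_le_add_three n2 n3 n6
      _ = _ := by ring
  rw [hasFDerivAt_iff_isLittleO_nhds_zero, Asymptotics.isLittleO_iff]
  intro c hc
  have hKne : K1 + 1 ≠ 0 := by positivity
  have hexp : 0 ≤ Real.exp (K1 + 1) - 1 := by linarith [Real.one_le_exp (by positivity : 0 ≤ K1 + 1)]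
  let C := (1 + K2) * K3 / (K1 + 1) * (Real.exp (K1 + 1) - 1)
  have hC : 0 ≤ C := by positivity
  have hε : 0 < min 1 (c / (C + 1)) := by positivity
  filter_upwards [key _ hε (min_le_left _ _)] with h hh
  refine (by simpa using hh : ‖U (p + h) 1 - U p 1 - ω p h (U p 1)‖ ≤ _).trans ?_
  rw [gronwallBound_of_K_ne_0 hKne]
  have : min 1 (c / (C + 1)) * C ≤ c := by
    calc min 1 (c / (C + 1)) * C ≤ (c / (C + 1)) * (C + 1) := by
          gcongr
          · exact min_le_right _ _
          · linarith
      _ = c := by field_simp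
  calc _ = (min 1 (c / (C + 1)) * C) * ‖h‖ := by simp only [C]; ring_nf
    _ ≤ _ := by gcongr

lemma boot {V F : Type*} [NormedAddCommGroup V] [NormedSpace ℝ V] [NormedAddCommGroup F]
    [NormedSpace ℝ F] (X : V → F) (f' : V → V →L[ℝ] F) (h : ∀ p, HasFDerivAt X (f' p) p)
    (step : ∀ n : ℕ, ContDiff ℝ n X → ContDiff ℝ n f') : ContDiff ℝ (⊤ : ℕ∞) X := by
  rw [contDiff_infty]
  intro n
  induction n with
  | zero =>
    exact contDiff_zero.2 (continuous_iff_continuousAt.2 fun p => (h p).continuousAt)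
  | succ n ih =>
    push_cast
    exact contDiff_succ_iff_hasFDerivAt.2 ⟨f', step n ih, h⟩

lemma comb_deriv {V F : Type*} [NormedAddCommGroup V] [NormedSpace ℝ V] [NormedAddCommGroup F]
    [NormedSpace ℝ F] (C1 C2 C3 C4 C5 : F) (f2 f3 f4 f5 : V → ℝ)
    (h2 : ContDiff ℝ (⊤ : ℕ∞) f2) (h3 : ContDiff ℝ (⊤ : ℕ∞) f3)
    (h4 : ContDiff ℝ (⊤ : ℕ∞) f4) (h5 : ContDiff ℝ (⊤ : ℕ∞) f5) :
    ContDiff ℝ (⊤ : ℕ∞) (fun p => C1 + f2 p • C2 + f3 p • C3 + f4 p • C4 + f5 p • C5) ∧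
    ∀ p a, fderiv ℝ (fun p => C1 + f2 p • C2 + f3 p • C3 + f4 p • C4 + f5 p • C5) p a =
      (fderiv ℝ f2 p a) • C2 + (fderiv ℝ f3 p a) • C3 + (fderiv ℝ f4 p a) • C4
        + (fderiv ℝ f5 p a) • C5 := by
  refine ⟨by fun_prop, fun p a => ?_⟩
  have d : ∀ {f : V → ℝ}, ContDiff ℝ (⊤ : ℕ∞) f → HasFDerivAt f (fderiv ℝ f p) p := fun h =>
    (h.differentiable (by simp) p).hasFDerivAt
  have := (((((d h2).smul_const C2).const_add C1).add ((d h3).smul_const C3)).add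
    ((d h4).smul_const C4)).add ((d h5).smul_const C5)
  have e : fderiv ℝ (fun p => C1 + f2 p • C2 + f3 p • C3 + f4 p • C4 + f5 p • C5) p = _ := this.fderiv
  rw [e]; simp

abbrev dx : VV →L[ℝ] ℝ := ContinuousLinearMap.fst ℝ ℝ ℝ
abbrev dy : VV →L[ℝ] ℝ := ContinuousLinearMap.snd ℝ ℝ ℝ

lemma lax (K Ks Kt Q Qs Qt Qss Qst Qsss Qsst : VV → ℝ)
    (sK : ContDiff ℝ (⊤ : ℕ∞) K) (sQ : ContDiff ℝ (⊤ : ℕ∞) Q) (sQs : ContDiff ℝ (⊤ : ℕ∞) Qs)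
    (sQss : ContDiff ℝ (⊤ : ℕ∞) Qss)
    (hK : ∀ p, HasFDerivAt K (Ks p • dx + Kt p • dy) p)
    (hQ : ∀ p, HasFDerivAt Q (Qs p • dx + Qt p • dy) p)
    (hQs : ∀ p, HasFDerivAt Qs (Qss p • dx + Qst p • dy) p)
    (hQss : ∀ p, HasFDerivAt Qss (Qsss p • dx + Qsst p • dy) p)
    (heq : ∀ p, Kt p = -(1/4) * (Qsss p + 4 * K p * Qs p + 2 * Ks p * Q p)) (x1 x2 : ℝ) :
    ∃ u w : VV → ℝ, ContDiff ℝ (⊤ : ℕ∞) u ∧ ContDiff ℝ (⊤ : ℕ∞) w ∧ u 0 = x1 ∧ w 0 = x2 ∧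
      (∀ p, HasFDerivAt u (w p • dx + (Qs p / 4 * u p - Q p / 2 * w p) • dy) p) ∧
      (∀ p, HasFDerivAt w ((-K p * u p) • dx +
        ((Qss p / 4 + K p * Q p / 2) * u p - Qs p / 4 * w p) • dy) p) := by
  let N1 : VV →L[ℝ] VV := dx.prod (-dy)
  let N2 : VV →L[ℝ] VV := dy.prod 0
  let N3 : VV →L[ℝ] VV := (0 : VV →L[ℝ] ℝ).prod dx
  have s2 : ContDiff ℝ (⊤ : ℕ∞) (fun p => -K p) := by fun_prop
  have s3 : ContDiff ℝ (⊤ : ℕ∞) (fun p => Qs p / 4) := by fun_prop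
  have s4 : ContDiff ℝ (⊤ : ℕ∞) (fun p => -Q p / 2) := by fun_prop
  have s5 : ContDiff ℝ (⊤ : ℕ∞) (fun p => Qss p / 4 + K p * Q p / 2) := by fun_prop
  have hc := comb_deriv (dx.smulRight N2) (dx.smulRight N3) (dy.smulRight N1) (dy.smulRight N2)
    (dy.smulRight N3) (fun p => -K p) (fun p => Qs p / 4) (fun p => -Q p / 2)
    (fun p => Qss p / 4 + K p * Q p / 2) s2 s3 s4 s5
  have d2 : ∀ p, fderiv ℝ (fun p => -K p) p = -(Ks p • dx + Kt p • dy) := fun p => (hK p).neg.fderiv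
  have d3 : ∀ p, fderiv ℝ (fun p => Qs p / 4) p = (4⁻¹ : ℝ) • (Qss p • dx + Qst p • dy) := fun p => by
    have := ((hQs p).mul_const (4⁻¹ : ℝ)).fderiv
    simp only [div_eq_mul_inv]; exact this
  have d4 : ∀ p, fderiv ℝ (fun p => -Q p / 2) p = (2⁻¹ : ℝ) • -(Qs p • dx + Qt p • dy) := fun p => by
    have := ((hQ p).neg.mul_const (2⁻¹ : ℝ)).fderiv
    simp only [div_eq_mul_inv]; exact this
  have d5 : ∀ p, fderiv ℝ (fun p => Qss p / 4 + K p * Q p / 2) p =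
      (4⁻¹ : ℝ) • (Qsss p • dx + Qsst p • dy) + (2⁻¹ : ℝ) • (K p • (Qs p • dx + Qt p • dy) +
        Q p • (Ks p • dx + Kt p • dy)) := fun p => by
    have := (((hQss p).mul_const (4⁻¹ : ℝ)).add (((hK p).mul (hQ p)).mul_const (2⁻¹ : ℝ))).fderiv
    simp only [div_eq_mul_inv]; exact this
  set ω : VV → VV →L[ℝ] VV →L[ℝ] VV := fun p => dx.smulRight N2 + (-K p) • dx.smulRight N3
    + (Qs p / 4) • dy.smulRight N1 + (-Q p / 2) • dy.smulRight N2
    + (Qss p / 4 + K p * Q p / 2) • dy.smulRight N3 with hω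
  obtain ⟨X, hX0, hX⟩ := frob lin_ode ω hc.1 (by
    intro x a b e
    rw [hc.2, hc.2, d2, d3, d4, d5]
    have := heq x
    ext
    · simp [hω, N1, N2, N3]
      ring
    · simp [hω, N1, N2, N3]
      rw [this]
      ring) (x1, x2)
  have hu : ∀ p, HasFDerivAt (fun p => (X p).1) ((X p).2 • dx +
      (Qs p / 4 * (X p).1 - Q p / 2 * (X p).2) • dy) p := fun p => by
    refine (hX p).fst.congr_fderiv ?_
    apply ContinuousLinearMap.ext
    intro e
    simp [hω, N1, N2, N3]
    ring
  have hw : ∀ p, HasFDerivAt (fun p => (X p).2) ((-K p * (X p).1) • dx +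
        ((Qss p / 4 + K p * Q p / 2) * (X p).1 - Qs p / 4 * (X p).2) • dy) p := fun p => by
    refine (hX p).snd.congr_fderiv ?_
    apply ContinuousLinearMap.ext
    intro e
    simp [hω, N1, N2, N3]
    ring
  have hXs : ContDiff ℝ (⊤ : ℕ∞) X := by
    refine boot X _ (fun p => (hu p).prodMk (hw p)) fun n hn => ?_
    have l : ∀ {f : VV → ℝ}, ContDiff ℝ (⊤ : ℕ∞) f → ContDiff ℝ n f := fun h => h.of_le (by exact_mod_cast le_top)
    have lK := l sK
    have lQ := l sQ
    have lQs := l sQs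
    have lQss := l sQss
    have l1 : ContDiff ℝ n (fun p => (X p).1) := hn.fst
    have l2 : ContDiff ℝ n (fun p => (X p).2) := hn.snd
    have m1 : ContDiff ℝ n (fun p => (X p).2 • dx +
      (Qs p / 4 * (X p).1 - Q p / 2 * (X p).2) • dy) := by fun_prop
    have m2 : ContDiff ℝ n (fun p => (-K p * (X p).1) • dx +
        ((Qss p / 4 + K p * Q p / 2) * (X p).1 - Qs p / 4 * (X p).2) • dy) := by fun_prop
    exact (ContinuousLinearMap.prodₗᵢ (E := VV) (F := ℝ) (G := ℝ) (𝕜 := ℝ) ℝ).contDiff.comp (m1.prodMk m2)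
  exact ⟨_, _, hXs.fst, hXs.snd, by simp [hX0], by simp [hX0], hu, hw⟩

lemma pd (f : ℝ → ℝ → ℝ) (hf : ContDiff ℝ (⊤ : ℕ∞) (fun p : VV => f p.1 p.2)) :
    ContDiff ℝ (⊤ : ℕ∞) (fun p : VV => dsR f p.1 p.2) ∧
    ∀ p : VV, HasFDerivAt (fun p : VV => f p.1 p.2) (dsR f p.1 p.2 • dx + dtR f p.1 p.2 • dy) p := by
  have hd : ∀ p : VV, HasFDerivAt (fun p : VV => f p.1 p.2) (fderiv ℝ (fun p : VV => f p.1 p.2) p) p :=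
    fun p => (hf.differentiable (by simp) p).hasFDerivAt
  have e1 : ∀ p : VV, dsR f p.1 p.2 = fderiv ℝ (fun p : VV => f p.1 p.2) p (1, 0) := fun p => by
    have h1 : HasDerivAt (fun x : ℝ => ((x, p.2) : VV)) (1, 0) p.1 :=
      (hasDerivAt_id p.1).prodMk (hasDerivAt_const p.1 p.2)
    exact (HasFDerivAt.comp_hasDerivAt p.1 (hd (p.1, p.2)) h1).deriv
  have e2 : ∀ p : VV, dtR f p.1 p.2 = fderiv ℝ (fun p : VV => f p.1 p.2) p (0, 1) := fun p => by
    have h1 : HasDerivAt (fun x : ℝ => ((p.1, x) : VV)) (0, 1) p.2 :=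
      (hasDerivAt_const p.2 p.1).prodMk (hasDerivAt_id p.2)
    exact (HasFDerivAt.comp_hasDerivAt p.2 (hd (p.1, p.2)) h1).deriv
  refine ⟨?_, fun p => (hd p).congr_fderiv ?_⟩
  · simp only [e1]
    exact ((contDiff_infty_iff_fderiv.1 hf).2).clm_apply contDiff_const
  · rw [e1, e2]
    ext <;> simp

lemma prim (T g : VV → ℝ) (T' g' : VV → VV →L[ℝ] ℝ)
    (sT : ContDiff ℝ (⊤ : ℕ∞) T) (sg : ContDiff ℝ (⊤ : ℕ∞) g)
    (hT : ∀ p, HasFDerivAt T (T' p) p) (hg : ∀ p, HasFDerivAt g (g' p) p)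
    (h : ∀ p, T' p (0, 1) = g' p (1, 0)) :
    ∃ G : VV → ℝ, ContDiff ℝ (⊤ : ℕ∞) G ∧ ∀ p, HasFDerivAt G (T p • dx + g p • dy) p := by
  have sθ : ContDiff ℝ (⊤ : ℕ∞) (fun p => T p • dx + g p • dy) := by fun_prop
  obtain ⟨G, hG⟩ := Convex.exists_forall_hasFDerivAt_of_fderiv_symmetric (s := Set.univ)
    (ω := fun p : VV => T p • dx + g p • dy) convex_univ isOpen_univ
    (sθ.differentiable (by simp)).differentiableOn (by
      intro p _ a b
      have e : fderiv ℝ (fun p : VV => T p • dx + g p • dy) p = _ :=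
        (((hT p).smul_const dx).add ((hg p).smul_const dy)).fderiv
      have hd : ∀ (L : VV →L[ℝ] ℝ) (a : VV), L a = a.1 * L (1, 0) + a.2 * L (0, 1) := fun L a => by
        have : a = a.1 • ((1, 0) : VV) + a.2 • ((0, 1) : VV) := by ext <;> simp
        conv_lhs => rw [this]
        rw [map_add, map_smul, map_smul]; rfl
      rw [e]
      simp only [add_apply, ContinuousLinearMap.smulRight_apply,
        smul_apply, ContinuousLinearMap.coe_fst', ContinuousLinearMap.coe_snd',
        smul_eq_mul]
      rw [hd (T' p) a, hd (T' p) b, hd (g' p) a, hd (g' p) b, h p]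
      ring)
  exact ⟨G, boot G _ (fun p => hG p (Set.mem_univ p)) fun n _ => sθ.of_le (by exact_mod_cast le_top),
    fun p => hG p (Set.mem_univ p)⟩

lemma quad (K Ks Kt Q Qs Qt Qss P Ps Pt Pss Pst Psss Psst : VV → ℝ)
    (sK : ContDiff ℝ (⊤ : ℕ∞) K) (sQ : ContDiff ℝ (⊤ : ℕ∞) Q) (sP : ContDiff ℝ (⊤ : ℕ∞) P)
    (sPs : ContDiff ℝ (⊤ : ℕ∞) Ps) (sPss : ContDiff ℝ (⊤ : ℕ∞) Pss)
    (hK : ∀ p, HasFDerivAt K (Ks p • dx + Kt p • dy) p)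
    (hQ : ∀ p, HasFDerivAt Q (Qs p • dx + Qt p • dy) p)
    (hP : ∀ p, HasFDerivAt P (Ps p • dx + Pt p • dy) p)
    (hPs : ∀ p, HasFDerivAt Ps (Pss p • dx + Pst p • dy) p)
    (hPss : ∀ p, HasFDerivAt Pss (Psss p • dx + Psst p • dy) p)
    (heq : ∀ p, Qs p = Psss p + 4 * K p * Ps p + 2 * Ks p * P p)
    (x w y z : VV → ℝ)
    (sx : ContDiff ℝ (⊤ : ℕ∞) x) (sw : ContDiff ℝ (⊤ : ℕ∞) w)
    (sy : ContDiff ℝ (⊤ : ℕ∞) y) (sz : ContDiff ℝ (⊤ : ℕ∞) z)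
    (hx : ∀ p, HasFDerivAt x (w p • dx + (Qs p / 4 * x p - Q p / 2 * w p) • dy) p)
    (hw : ∀ p, HasFDerivAt w ((-K p * x p) • dx +
        ((Qss p / 4 + K p * Q p / 2) * x p - Qs p / 4 * w p) • dy) p)
    (hy : ∀ p, HasFDerivAt y (z p • dx + (Qs p / 4 * y p - Q p / 2 * z p) • dy) p)
    (hz : ∀ p, HasFDerivAt z ((-K p * y p) • dx +
        ((Qss p / 4 + K p * Q p / 2) * y p - Qs p / 4 * z p) • dy) p) :
    ∃ G : VV → ℝ, ContDiff ℝ (⊤ : ℕ∞) G ∧ ∀ p, HasFDerivAt G ((x p * y p) • dx +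
      ((Pss p + 2 * (K p * P p) - 2⁻¹ * Q p) * (x p * y p) - Ps p * (w p * y p + x p * z p)
        + P p * (2 * (w p * z p))) • dy) p := by
  refine prim (fun p => x p * y p) (fun p => (Pss p + 2 * (K p * P p) - 2⁻¹ * Q p) * (x p * y p)
    - Ps p * (w p * y p + x p * z p) + P p * (2 * (w p * z p))) _ _ (by fun_prop) (by fun_prop)
    (fun p => (hx p).mul (hy p))
    (fun p => ((((((hPss p).add (((hK p).mul (hP p)).const_mul 2)).sub ((hQ p).const_mul 2⁻¹)).mul
      ((hx p).mul (hy p))).sub ((hPs p).mul (((hw p).mul (hy p)).add ((hx p).mul (hz p))))).add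
      ((hP p).mul (((hw p).mul (hz p)).const_mul 2)))) ?_
  intro p
  have := heq p
  simp
  linear_combination (x p * y p) * this

lemma slice1 (F : VV → ℝ) (a b s t : ℝ) (h : HasFDerivAt F (a • dx + b • dy) (s, t)) :
    HasDerivAt (fun x => F (x, t)) a s := by
  have := h.comp_hasDerivAt s ((hasDerivAt_id s).prodMk (hasDerivAt_const s t))
  simpa [Function.comp_def] using this

lemma slice2 (F : VV → ℝ) (a b s t : ℝ) (h : HasFDerivAt F (a • dx + b • dy) (s, t)) :
    HasDerivAt (fun x => F (s, x)) b t := by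
  have := h.comp_hasDerivAt t ((hasDerivAt_const t s).prodMk (hasDerivAt_id t))
  simpa [Function.comp_def] using this

lemma vec3 (f g h : ℝ → ℝ) (f' g' h' s : ℝ) (hf : HasDerivAt f f' s) (hg : HasDerivAt g g' s)
    (hh : HasDerivAt h h' s) : deriv (fun x => ![f x, g x, h x]) s = ![f', g', h'] := by
  apply HasDerivAt.deriv
  rw [hasDerivAt_pi]
  intro i
  fin_cases i
  · exact hf
  · exact hg
  · exact hh

/-- given smooth `κ, p₃, q` satisfying `∂q/∂s = 𝒟p₃` and
`∂κ/∂t = -(1/4)𝒟q`, there is a motion of pseudo-arc parametrized null curves with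
curvature `κ` and variation field `p₁ t + p₂ n + p₃ b`, where
`p₁ = ∂²p₃/∂s² + 2κp₃ - q/2` and `p₂ = -∂p₃/∂s`. -/
theorem stmt8 (κ p₃ q : ℝ → ℝ → ℝ)
    (hκ : ContDiff ℝ (⊤ : ℕ∞) (fun p : ℝ × ℝ => κ p.1 p.2))
    (hp₃ : ContDiff ℝ (⊤ : ℕ∞) (fun p : ℝ × ℝ => p₃ p.1 p.2))
    (hq : ContDiff ℝ (⊤ : ℕ∞) (fun p : ℝ × ℝ => q p.1 p.2))
    (heq1 : ∀ s t : ℝ,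
      dsR q s t =
        dsR (dsR (dsR p₃)) s t + 4 * κ s t * dsR p₃ s t + 2 * dsR κ s t * p₃ s t)
    (heq2 : ∀ s t : ℝ,
      dtR κ s t =
        -(1/4) * (dsR (dsR (dsR q)) s t + 4 * κ s t * dsR q s t + 2 * dsR κ s t * q s t))
    (p₁ p₂ : ℝ → ℝ → ℝ)
    (hp₁ : ∀ s t, p₁ s t = dsR (dsR p₃) s t + 2 * κ s t * p₃ s t - q s t / 2)
    (hp₂ : ∀ s t, p₂ s t = -dsR p₃ s t) :
    ∃ Γ : ℝ → ℝ → Fin 3 → ℝ,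
      ContDiff ℝ (⊤ : ℕ∞) (fun p : ℝ × ℝ => Γ p.1 p.2) ∧
      (∀ t s : ℝ,
        mink (dsV Γ s t) (dsV Γ s t) = 0 ∧
        mink (dsV Γ s t) ![1, 0, 1] < 0 ∧
        mink (dsV (dsV Γ) s t) (dsV (dsV Γ) s t) = 1 ∧
        (1/4) * mink (dsV (dsV (dsV Γ)) s t) (dsV (dsV (dsV Γ)) s t) = κ s t) ∧
      (∀ s t : ℝ,
        dtV Γ s t = p₁ s t • dsV Γ s t + p₂ s t • dsV (dsV Γ) s t +
          p₃ s t • (dsV (dsV (dsV Γ)) s t + (2 * κ s t) • dsV Γ s t)) := by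
  obtain ⟨sKs, hK⟩ := pd κ hκ
  obtain ⟨sQs, hQ⟩ := pd q hq
  obtain ⟨sQss, hQs⟩ := pd _ sQs
  obtain ⟨-, hQss⟩ := pd _ sQss
  obtain ⟨sPs, hP⟩ := pd p₃ hp₃
  obtain ⟨sPss, hPs⟩ := pd _ sPs
  obtain ⟨-, hPss⟩ := pd _ sPss
  have L := lax _ _ _ _ _ _ _ _ _ _ hκ hq sQs sQss hK hQ hQs hQss (fun p => heq2 p.1 p.2)
  have Qd := quad _ _ _ _ _ _ (fun p => dsR (dsR q) p.1 p.2) _ _ _ _ _ _ _ hκ hq hp₃ sPs sPss hK hQ hP hPs hPss (fun p => heq1 p.1 p.2)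
  obtain ⟨u, w, su, sw, hu0, hw0, hu, hw⟩ := L 1 0
  obtain ⟨v, z, sv, sz, hv0, hz0, hv, hz⟩ := L 0 (√2)⁻¹
  have r2 : √2 * √2 = (2:ℝ) := Real.mul_self_sqrt (by norm_num)
  have W : ∀ p, u p * z p - w p * v p = (√2)⁻¹ := by
    intro p
    have hd : ∀ p, HasFDerivAt (fun p => u p * z p - w p * v p) (0 : VV →L[ℝ] ℝ) p := fun p => by
      refine (((hu p).mul (hz p)).sub ((hw p).mul (hv p))).congr_fderiv ?_
      ext
      · simp; ring
      · simp; ring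
    have := is_const_of_fderiv_eq_zero (𝕜 := ℝ) (fun p => (hd p).differentiableAt) (fun p => (hd p).fderiv) p 0
    simpa [hu0, hz0, hw0, hv0] using this
  have W2 : ∀ p, 2 * (u p * z p - w p * v p) ^ 2 = 1 := fun p => by
    rw [W, inv_pow, sq, r2]; norm_num
  obtain ⟨G1, sG1, hG1⟩ := Qd u w u w su sw su sw hu hw hu hw
  obtain ⟨G2, sG2, hG2⟩ := Qd u w v z su sw sv sz hu hw hv hz
  obtain ⟨G3, sG3, hG3⟩ := Qd v z v z sv sz sv sz hv hz hv hz
  let Γ : ℝ → ℝ → Fin 3 → ℝ := fun s t => ![G1 (s, t), √2 * G2 (s, t), G3 (s, t)]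
  have D1 : dsV Γ = fun s t => ![u (s, t) * u (s, t), √2 * (u (s, t) * v (s, t)), v (s, t) * v (s, t)] := by
    funext s t
    exact vec3 _ _ _ _ _ _ s (slice1 _ _ _ s t (hG1 _)) ((slice1 _ _ _ s t (hG2 _)).const_mul _)
      (slice1 _ _ _ s t (hG3 _))
  have du : ∀ s t, HasDerivAt (fun x => u (x, t)) (w (s, t)) s := fun s t => slice1 _ _ _ s t (hu (s, t))
  have dv : ∀ s t, HasDerivAt (fun x => v (x, t)) (z (s, t)) s := fun s t => slice1 _ _ _ s t (hv (s, t))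
  have dw : ∀ s t, HasDerivAt (fun x => w (x, t)) (-κ s t * u (s, t)) s := fun s t => slice1 _ _ _ s t (hw (s, t))
  have dz : ∀ s t, HasDerivAt (fun x => z (x, t)) (-κ s t * v (s, t)) s := fun s t => slice1 _ _ _ s t (hz (s, t))
  have D2 : dsV (dsV Γ) = fun s t => ![w (s, t) * u (s, t) + u (s, t) * w (s, t),
      √2 * (w (s, t) * v (s, t) + u (s, t) * z (s, t)), z (s, t) * v (s, t) + v (s, t) * z (s, t)] := by
    rw [D1]
    funext s t
    exact vec3 _ _ _ _ _ _ s ((du s t).mul (du s t)) (((du s t).mul (dv s t)).const_mul _)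
      ((dv s t).mul (dv s t))
  have D3 : dsV (dsV (dsV Γ)) = fun s t =>
      ![2 * (w (s, t) * w (s, t)) - 2 * κ s t * (u (s, t) * u (s, t)),
      √2 * (2 * (w (s, t) * z (s, t)) - 2 * κ s t * (u (s, t) * v (s, t))),
      2 * (z (s, t) * z (s, t)) - 2 * κ s t * (v (s, t) * v (s, t))] := by
    rw [D2]
    funext s t
    refine (vec3 _ _ _ _ _ _ s (((dw s t).mul (du s t)).add ((du s t).mul (dw s t)))
      ((((dw s t).mul (dv s t)).add ((du s t).mul (dz s t))).const_mul _)
      (((dz s t).mul (dv s t)).add ((dv s t).mul (dz s t)))).trans ?_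
    congr 1
    · ring
    · congr 1
      · ring
      · congr 1
        ring
  refine ⟨Γ, ?_, fun t s => ?_, fun s t => ?_⟩
  · rw [contDiff_pi]
    intro i
    fin_cases i
    · exact sG1
    · exact contDiff_const.mul sG2
    · exact sG3
  · rw [D3, D2, D1]
    have w2 := W2 (s, t)
    refine ⟨?_, ?_, ?_, ?_⟩
    · simp [mink]
      linear_combination (u (s, t) * v (s, t)) ^ 2 * r2
    · simp [mink]
      by_contra hn
      have a1 : u (s, t) = 0 := by nlinarith [mul_self_nonneg (u (s, t)), mul_self_nonneg (v (s, t))]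
      have a2 : v (s, t) = 0 := by nlinarith [mul_self_nonneg (u (s, t)), mul_self_nonneg (v (s, t))]
      rw [a1, a2] at w2
      norm_num at w2
    · simp [mink]
      linear_combination (w (s, t) * v (s, t) + u (s, t) * z (s, t)) ^ 2 * r2 + w2
    · simp [mink]
      linear_combination (1/4) * (2 * (w (s, t) * z (s, t)) - 2 * κ s t * (u (s, t) * v (s, t))) ^ 2 * r2
        + κ s t * w2
  · rw [D3, D2, D1]
    refine (vec3 _ _ _ _ _ _ t (slice2 _ _ _ s t (hG1 _)) ((slice2 _ _ _ s t (hG2 _)).const_mul _)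
      (slice2 _ _ _ s t (hG3 _))).trans ?_
    rw [hp₁, hp₂]
    ext i
    fin_cases i
    · simp; ring
    · simp; ring
    · simp; ring
end
end
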